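/- arXiv:2109.03855 — 2 statements merged into one kernel-verified Lean document; each statement's English description precedes it below -/
import Mathlib

section
/- Let V be a finite-dimensional, first-quadrant bigraded vector space over ℚ of slope C ∈ ℚ, and let M be a finitely generated bigraded Sym(V)-module. Then every ray of slope C in M is a Sym(V)-submodule, and its graded dimension is eventually equal to a quasi-polynomial of degree at most dim_ℚ V^0 − 1 and period dividing lcm(V^0). -/
/-!
Statement 1: Let `V` be a finite dimensional, first-quadrant bigraded vector space over ℚ
of slope `C`, and `M` a finitely generated bigraded `Sym(V)`-module.  Then every ray of
slope `C` in `M` is a `Sym(V)`-submodule, and its graded dimension is eventually equal to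
a quasi-polynomial of degree at most `dim V⁰ − 1` and period dividing `lcm(V⁰)`.

A bigraded vector space is encoded as a family `V : ℤ × ℤ → Type` of ℚ-vector spaces,
`(n, i)` recording weight `n` and homological degree `i`.  `Sym(V)` is the free
bigraded-commutative algebra on `V` (Koszul signs depending only on homological degree),
constructed as a quotient of the tensor algebra on `⊕ V_p`.
-/

open scoped DirectSum

variable (V : ℤ × ℤ → Type) [∀ p, AddCommGroup (V p)] [∀ p, Module ℚ (V p)]

/-- The Koszul sign commutation relation defining the free bigraded-commutative algebra:
generators of homological degrees `i`, `j` commute up to the sign `(-1)^(i*j)`. -/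
inductive GSymRel : TensorAlgebra ℚ (⨁ p, V p) → TensorAlgebra ℚ (⨁ p, V p) → Prop
  | comm (p q : ℤ × ℤ) (x : V p) (y : V q) :
      GSymRel (TensorAlgebra.ι ℚ (DirectSum.of V p x) * TensorAlgebra.ι ℚ (DirectSum.of V q y))
        (((-1 : ℚ) ^ (p.2 * q.2)) •
          (TensorAlgebra.ι ℚ (DirectSum.of V q y) * TensorAlgebra.ι ℚ (DirectSum.of V p x)))

/-- The free bigraded-commutative algebra `Sym(V)` on the bigraded vector space `V`
(polynomial on even-degree generators, exterior on odd-degree generators). -/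
def GSym := RingQuot (GSymRel V)

noncomputable instance : Ring (GSym V) := inferInstanceAs (Ring (RingQuot (GSymRel V)))
noncomputable instance : Algebra ℚ (GSym V) :=
  inferInstanceAs (Algebra ℚ (RingQuot (GSymRel V)))

/-- The generator of `Sym(V)` corresponding to `x ∈ V_p`. -/
noncomputable def GSym.gen (p : ℤ × ℤ) (x : V p) : GSym V :=
  RingQuot.mkAlgHom ℚ (GSymRel V) (TensorAlgebra.ι ℚ (DirectSum.of V p x))

/-- The bigraded piece of `Sym(V)` of bidegree `p`: the span of the monomials in
bihomogeneous generators whose bidegrees sum to `p`. -/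
noncomputable def GSym.grade (p : ℤ × ℤ) : Submodule ℚ (GSym V) :=
  Submodule.span ℚ {a : GSym V | ∃ l : List (Σ q : ℤ × ℤ, V q),
    (l.map Sigma.fst).sum = p ∧ a = (l.map fun t => GSym.gen V t.1 t.2).prod}

/-- `V` is of finite type if each bigraded piece is finite dimensional. -/
def Bigraded.FiniteType : Prop := ∀ p, FiniteDimensional ℚ (V p)

/-- `V` is first-quadrant if it vanishes in negative weights and in negative degrees. -/
def Bigraded.FirstQuadrant : Prop :=
  ∀ p : ℤ × ℤ, (p.1 < 0 ∨ p.2 < 0) → Subsingleton (V p)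

/-- `V` is of slope `C` if every nonvanishing bigraded piece `V_{n,i}` has `n ≠ 0` and
`i / n = C`. -/
def Bigraded.OfSlope (C : ℚ) : Prop :=
  ∀ p : ℤ × ℤ, Nontrivial (V p) → p.1 ≠ 0 ∧ (p.2 : ℚ) / (p.1 : ℚ) = C

open Polynomial in
/-- eventual quasi-polynomiality -/
def QPoly (T : ℕ) (k : ℕ) (f : ℤ → ℚ) : Prop :=
  ∃ P : ZMod T → Polynomial ℚ, (∀ j, (P j).degree < (k : WithBot ℕ)) ∧
    ∃ N : ℤ, ∀ n : ℤ, N ≤ n → f n = (P (n : ZMod T)).eval (n : ℚ)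

namespace QPoly

open Polynomial

variable {T k : ℕ} {f g : ℤ → ℚ}

lemma congr_ev (hf : QPoly T k f) (N₀ : ℤ) (h : ∀ n, N₀ ≤ n → g n = f n) : QPoly T k g := by
  obtain ⟨P, hP, N, hN⟩ := hf
  refine ⟨P, hP, max N N₀, fun n hn => ?_⟩
  rw [h n (le_trans (le_max_right _ _) hn), hN n (le_trans (le_max_left _ _) hn)]

lemma zero : QPoly T k (fun _ => 0) :=
  ⟨fun _ => 0, fun _ => by simp, 0, fun n _ => by simp⟩

lemma add (hf : QPoly T k f) (hg : QPoly T k g) : QPoly T k (fun n => f n + g n) := by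
  obtain ⟨P, hP, N, hN⟩ := hf
  obtain ⟨P', hP', N', hN'⟩ := hg
  refine ⟨fun j => P j + P' j, fun j => ?_, max N N', fun n hn => ?_⟩
  · exact lt_of_le_of_lt (degree_add_le _ _) (max_lt (hP j) (hP' j))
  · simp only [eval_add]
    rw [hN n (le_trans (le_max_left _ _) hn), hN' n (le_trans (le_max_right _ _) hn)]

lemma neg (hf : QPoly T k f) : QPoly T k (fun n => - f n) := by
  obtain ⟨P, hP, N, hN⟩ := hf
  refine ⟨fun j => - P j, fun j => by simpa using hP j, N, fun n hn => ?_⟩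
  simp [hN n hn]

lemma shift (hf : QPoly T k f) (d : ℤ) : QPoly T k (fun n => f (n + d)) := by
  obtain ⟨P, hP, N, hN⟩ := hf
  refine ⟨fun j => (P (j + (d : ZMod T))).comp (X + C (d : ℚ)), fun j => ?_, N - d,
    fun n hn => ?_⟩
  · rcases eq_or_ne (P (j + (d : ZMod T))) 0 with h0 | h0
    · simp [h0]
    · have h1 := hP (j + (d : ZMod T))
      rw [← natDegree_lt_iff_degree_lt h0] at h1
      refine lt_of_le_of_lt degree_le_natDegree ?_
      rw [natDegree_comp, natDegree_X_add_C, mul_one]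
      exact_mod_cast h1
  · have := hN (n + d) (by linarith)
    simp only [this]
    simp

lemma exists_antidiff (t : ℚ) (ht : t ≠ 0) (k : ℕ) (p : ℚ[X]) (hp : p.degree < (k : WithBot ℕ)) :
    ∃ q : ℚ[X], q.degree < ((k + 1 : ℕ) : WithBot ℕ) ∧
      ∀ x : ℚ, q.eval (x + t) - q.eval x = p.eval x := by
  induction k generalizing p with
  | zero =>
    have : p = 0 := by
      rw [← degree_eq_bot]
      by_contra h
      rw [degree_eq_bot] at h
      rw [degree_eq_natDegree h] at hp
      simp at hp
    exact ⟨0, by simp, by simp [this]⟩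
  | succ k ih =>
    set c := p.coeff k with hc
    set q0 : ℚ[X] := C (c / (t * (k + 1))) * X ^ (k + 1) with hq0
    have hk : (k : ℚ) + 1 ≠ 0 := by positivity
    set r : ℚ[X] := p - (q0.comp (X + C t) - q0) with hr
    have hrd : r.degree < (k : WithBot ℕ) := by
      rw [degree_lt_iff_coeff_zero]
      intro m hm
      have hq : (q0.comp (X + C t)).coeff m = c / (t * (k+1)) * (t ^ (k + 1 - m) * ((k+1).choose m : ℚ)) := by
        simp only [hq0, mul_comp, C_comp, pow_comp, X_comp, coeff_C_mul]
        rw [coeff_X_add_C_pow]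
      rw [hr, coeff_sub, coeff_sub, hq, hq0, coeff_C_mul, coeff_X_pow]
      rcases Nat.lt_or_ge k m with h | h
      · have : p.coeff m = 0 := by
          apply coeff_eq_zero_of_degree_lt
          refine lt_of_lt_of_le hp ?_
          exact_mod_cast h
        rw [this]
        rcases Nat.lt_or_ge (k+1) m with h' | h'
        · rw [Nat.choose_eq_zero_of_lt h', if_neg (by omega)]; simp
        · have : m = k + 1 := by omega
          subst this
          simp
      · have : m = k := by omega
        subst this
        rw [if_neg (by omega)]
        simp only [Nat.choose_succ_self_right, ← hc]
        have : m + 1 - m = 1 := by omega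
        rw [this]
        push_cast
        field_simp
        ring
    obtain ⟨q, hq, hq'⟩ := ih r hrd
    refine ⟨q + q0, ?_, fun x => ?_⟩
    · refine lt_of_le_of_lt (degree_add_le _ _) (max_lt (lt_trans hq ?_) ?_)
      · exact_mod_cast Nat.lt_succ_self _
      · refine lt_of_le_of_lt (degree_C_mul_X_pow_le _ _) ?_
        exact_mod_cast Nat.lt_succ_self _
    · have := hq' x
      rw [hr] at this
      simp only [eval_sub, eval_comp, eval_add, eval_X, eval_C] at this ⊢
      linarith

lemma mul_shift (d : ℤ) (h : QPoly T k (fun n => f (n + d) - f n)) (m : ℕ) :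
    QPoly T k (fun n => f (n + d * m) - f n) := by
  induction m with
  | zero => simpa using (zero : QPoly T k _)
  | succ m ih =>
    refine ((h.shift (d * m)).add ih).congr_ev 0 fun n _ => ?_
    have : n + d * ((m + 1 : ℕ) : ℤ) = n + d * m + d := by push_cast; ring
    rw [this]; ring

lemma of_diff (hT : 0 < T) (d : ℤ) (hd : 0 < d) (hdT : d ∣ (T : ℤ))
    (h : QPoly T k (fun n => f (n + d) - f n)) : QPoly T (k + 1) f := by
  obtain ⟨e, he⟩ := hdT
  have he0 : 0 ≤ e := by
    by_contra hneg
    push Not at hneg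
    have : (0 : ℤ) < T := by exact_mod_cast hT
    nlinarith
  lift e to ℕ using he0
  have h2 := mul_shift d h e
  rw [← he] at h2
  obtain ⟨P, hP, N, hN⟩ := h2
  have hT0 : (T : ℚ) ≠ 0 := by exact_mod_cast hT.ne'
  choose q hq hq' using fun j => exists_antidiff (T : ℚ) hT0 k (P j) (hP j)
  have : NeZero T := ⟨hT.ne'⟩
  -- the difference is eventually periodic
  set D : ℤ → ℚ := fun n => f n - (q (n : ZMod T)).eval (n : ℚ) with hD
  have hper : ∀ n, N ≤ n → D (n + T) = D n := by
    intro n hn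
    have h1 := hN n hn
    have h2 := hq' (n : ZMod T) (n : ℚ)
    simp only [hD]
    push_cast
    simp only [CharP.cast_eq_zero, add_zero]
    linarith
  have hper2 : ∀ (u : ℕ) n, N ≤ n → D (n + T * u) = D n := by
    intro u
    induction u with
    | zero => simp
    | succ u ih =>
      intro n hn
      have : n + (T : ℤ) * ((u + 1 : ℕ) : ℤ) = (n + T * u) + T := by push_cast; ring
      rw [this, hper _ (by nlinarith [Nat.zero_le u, Nat.zero_le T, mul_nonneg (Int.natCast_nonneg T) (Int.natCast_nonneg u)]), ih n hn]
  -- representative of class j above N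
  let ρ : ZMod T → ℤ := fun j => N + (((j - (N : ZMod T)).val : ℕ) : ℤ)
  refine ⟨fun j => q j + C (D (ρ j)), fun j => ?_, N + T, fun n hn => ?_⟩
  · refine lt_of_le_of_lt (degree_add_le _ _) (max_lt (hq j) (lt_of_le_of_lt degree_C_le ?_))
    exact_mod_cast Nat.succ_pos k
  · have hρN : N ≤ ρ n := by simp only [ρ]; omega
    have hρT : ρ n < N + T := by
      have := ZMod.val_lt ((n : ZMod T) - (N : ZMod T))
      simp only [ρ]; omega
    have hρc : ((ρ n : ℤ) : ZMod T) = (n : ZMod T) := by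
      simp [ρ]
    have hdvd : (T : ℤ) ∣ n - ρ n := (ZMod.intCast_eq_intCast_iff_dvd_sub _ _ _).1 hρc
    obtain ⟨u, hu⟩ := hdvd
    have hu0 : 0 ≤ u := by
      by_contra hneg
      push Not at hneg
      have : (0 : ℤ) < T := by exact_mod_cast hT
      nlinarith
    lift u to ℕ using hu0
    have h3 := hper2 u (ρ n) hρN
    have h4 : ρ n + T * u = n := by linarith
    rw [h4] at h3
    simp only [eval_add, eval_C]
    rw [← h3]
    simp [hD]

end QPoly

section Graded

open MvPolynomial

lemma finrank_map_add_ker_inf {M : Type} [AddCommGroup M] [Module ℚ M] (x : M →ₗ[ℚ] M)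
    (A : Submodule ℚ M) [FiniteDimensional ℚ A] :
    Module.finrank ℚ (A.map x) + Module.finrank ℚ (A ⊓ LinearMap.ker x : Submodule ℚ M)
      = Module.finrank ℚ A := by
  have h := LinearMap.finrank_range_add_finrank_ker (x.domRestrict A)
  rw [← h, LinearMap.range_domRestrict, LinearMap.ker_domRestrict]
  congr 1
  have e := LinearEquiv.finrank_eq (Submodule.equivMapOfInjective A.subtype A.injective_subtype
    ((LinearMap.ker x).comap A.subtype))
  rw [Submodule.map_comap_subtype] at e
  exact e.symm

/-- a graded module over a polynomial ring, given by projections -/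
structure GrData {ι : Type} {M : Type} [AddCommGroup M] [Module ℚ M] [Module (MvPolynomial ι ℚ) M]
    (d : ι → ℤ) (𝒩 : ℤ → Submodule ℚ M) (π : ℤ → M →ₗ[ℚ] M) : Prop where
  mem : ∀ n m, π n m ∈ 𝒩 n
  same : ∀ n m, m ∈ 𝒩 n → π n m = m
  ne : ∀ n n' m, m ∈ 𝒩 n → n' ≠ n → π n' m = 0
  smul : ∀ i n m, π (n + d i) ((X i : MvPolynomial ι ℚ) • m) = (X i : MvPolynomial ι ℚ) • π n m
  ev : ∀ m, ∃ N : ℤ, ∀ n, N ≤ n → π n m = 0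
  pos : ∀ i, 0 < d i

variable {ι : Type} {M : Type} [AddCommGroup M] [Module ℚ M] [Module (MvPolynomial ι ℚ) M]
  [IsScalarTower ℚ (MvPolynomial ι ℚ) M]


lemma le_sup_span (G : Set M) (Q : Submodule (MvPolynomial ι ℚ) M)
    (h : ∀ i, ∀ p ∈ Submodule.span (MvPolynomial ι ℚ) G, (X i : MvPolynomial ι ℚ) • p ∈ Q) :
    (Submodule.span (MvPolynomial ι ℚ) G).restrictScalars ℚ ≤
      Q.restrictScalars ℚ ⊔ Submodule.span ℚ G := by
  intro p hp
  have hp' : p ∈ Submodule.span (MvPolynomial ι ℚ) G := hp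
  induction hp' using Submodule.span_induction with
  | mem x hx => exact Submodule.mem_sup_right (Submodule.subset_span hx)
  | zero => exact zero_mem _
  | add x y hx hy ihx ihy => exact add_mem (ihx hx) (ihy hy)
  | smul r x hx ih =>
    have ih := ih hx
    clear hp
    induction r using MvPolynomial.induction_on with
    | C c =>
      rw [← MvPolynomial.algebraMap_eq, algebraMap_smul]
      exact Submodule.smul_mem _ _ ih
    | add f g hf hg => rw [add_smul]; exact add_mem hf hg
    | mul_X f i hf =>
      rw [mul_smul]
      exact Submodule.mem_sup_left (Q.smul_mem f (h i x hx))

/-- multiplication by a variable as a rational linear map -/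
noncomputable def mulX (M : Type) [AddCommGroup M] [Module ℚ M] [Module (MvPolynomial ι ℚ) M]
    [IsScalarTower ℚ (MvPolynomial ι ℚ) M] (i : ι) : M →ₗ[ℚ] M :=
  (LinearMap.lsmul (MvPolynomial ι ℚ) M (X i)).restrictScalars ℚ

lemma mulX_apply (i : ι) (m : M) : mulX M i m = (X i : MvPolynomial ι ℚ) • m := rfl

variable {d : ι → ℤ} {𝒩 : ℤ → Submodule ℚ M} {π : ℤ → M →ₗ[ℚ] M}

namespace GrData

lemma smul_mem (H : GrData d 𝒩 π) (i : ι) (n : ℤ) (m : M) (hm : m ∈ 𝒩 n) :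
    (X i : MvPolynomial ι ℚ) • m ∈ 𝒩 (n + d i) := by
  rw [← H.same n m hm, ← H.smul]
  exact H.mem _ _

lemma smul' (H : GrData d 𝒩 π) (i : ι) (n : ℤ) (m : M) :
    π n ((X i : MvPolynomial ι ℚ) • m) = (X i : MvPolynomial ι ℚ) • π (n - d i) m := by
  rw [← H.smul]; simp

lemma stable_of_X (W : Submodule ℚ M) (h : ∀ i, ∀ m ∈ W, (X i : MvPolynomial ι ℚ) • m ∈ W)
    (r : MvPolynomial ι ℚ) (m : M) (hm : m ∈ W) : r • m ∈ W := by
  induction r using MvPolynomial.induction_on generalizing m with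
  | C c =>
    rw [← MvPolynomial.algebraMap_eq, algebraMap_smul]
    exact Submodule.smul_mem _ _ hm
  | add f g hf hg => rw [add_smul]; exact add_mem (hf m hm) (hg m hm)
  | mul_X f i hf => rw [mul_smul]; exact hf _ (h i m hm)

/-- elements supported in weights at least `n` -/
def tail (H : GrData d 𝒩 π) (n : ℤ) : Submodule (MvPolynomial ι ℚ) M where
  carrier := {m | ∀ n' < n, π n' m = 0}
  add_mem' := by
    intro a b ha hb n' hn'
    rw [map_add, ha n' hn', hb n' hn', add_zero]
  zero_mem' := by intro n' _; exact map_zero _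
  smul_mem' := by
    intro r m hm
    let W : Submodule ℚ M := ⨅ n' : {n' : ℤ // n' < n}, LinearMap.ker (π n')
    have hW : ∀ m, m ∈ W ↔ ∀ n' < n, π n' m = 0 := by
      intro m; simp [W]
    refine (hW _).1 (stable_of_X W ?_ r m ((hW _).2 hm))
    intro i m hm
    rw [hW] at hm ⊢
    intro n' hn'
    rw [H.smul', hm _ (by linarith [H.pos i]), smul_zero]

lemma finiteDimensional (H : GrData d 𝒩 π) [IsNoetherian (MvPolynomial ι ℚ) M] (n : ℤ) :
    FiniteDimensional ℚ (𝒩 n) := by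
  obtain ⟨G, hG⟩ := IsNoetherian.noetherian (H.tail n)
  have h1 := le_sup_span (G : Set M) (H.tail (n + 1)) (by
    intro i p hp n' hn'
    rw [hG] at hp
    rw [H.smul', hp _ (by linarith [H.pos i]), smul_zero])
  have h2 : 𝒩 n ≤ (Submodule.span ℚ (G : Set M)).map (π n) := by
    intro m hm
    have : m ∈ (Submodule.span (MvPolynomial ι ℚ) (G : Set M)).restrictScalars ℚ := by
      rw [hG]
      intro n' hn'
      exact H.ne n n' m hm hn'.ne
    obtain ⟨q, hq, g, hg, hqg⟩ := Submodule.mem_sup.1 (h1 this)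
    refine ⟨g, hg, ?_⟩
    have hq0 : π n q = 0 := hq n (by linarith)
    rw [← H.same n m hm, ← hqg, map_add, hq0, zero_add]
  have : FiniteDimensional ℚ (Submodule.span ℚ (G : Set M)) :=
    FiniteDimensional.span_of_finite ℚ G.finite_toSet
  exact Submodule.finiteDimensional_of_le h2

/-- Hilbert function of a submodule -/
noncomputable def hilb (𝒩 : ℤ → Submodule ℚ M) (P : Submodule (MvPolynomial ι ℚ) M) (n : ℤ) : ℚ :=
  (Module.finrank ℚ (P.restrictScalars ℚ ⊓ 𝒩 n : Submodule ℚ M) : ℚ)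

lemma hilb_step (H : GrData d 𝒩 π) [IsNoetherian (MvPolynomial ι ℚ) M] (i : ι)
    (P Q P' Q' : Submodule (MvPolynomial ι ℚ) M)
    (hP : ∀ n, ∀ p ∈ P, π n p ∈ P) (hQ : ∀ n, ∀ p ∈ Q, π n p ∈ Q)
    (hP' : ∀ m, m ∈ P' ↔ m ∈ P ∧ (X i : MvPolynomial ι ℚ) • m ∈ Q)
    (hQ' : Q' = Q ⊔ P.map (LinearMap.lsmul (MvPolynomial ι ℚ) M (X i))) (n : ℤ) :
    hilb 𝒩 P n - hilb 𝒩 P' n = hilb 𝒩 Q' (n + d i) - hilb 𝒩 Q (n + d i) := by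
  have hfd := H.finiteDimensional
  set Pn := (P.restrictScalars ℚ ⊓ 𝒩 n : Submodule ℚ M) with hPn
  set P'n := (P'.restrictScalars ℚ ⊓ 𝒩 n : Submodule ℚ M) with hP'n
  set Qn := (Q.restrictScalars ℚ ⊓ 𝒩 (n + d i) : Submodule ℚ M) with hQn
  set Q'n := (Q'.restrictScalars ℚ ⊓ 𝒩 (n + d i) : Submodule ℚ M) with hQ'n
  have := hfd n
  have := hfd (n + d i)
  have f1 : FiniteDimensional ℚ Pn := Submodule.finiteDimensional_of_le inf_le_right
  have f2 : FiniteDimensional ℚ P'n := Submodule.finiteDimensional_of_le inf_le_right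
  have f3 : FiniteDimensional ℚ Qn := Submodule.finiteDimensional_of_le inf_le_right
  have e1 := finrank_map_add_ker_inf (mulX M i) Pn
  have e2 := finrank_map_add_ker_inf (mulX M i) P'n
  have e3 := Submodule.finrank_sup_add_finrank_inf_eq (Pn.map (mulX M i)) Qn
  have k1 : P'n ⊓ LinearMap.ker (mulX M i) = Pn ⊓ LinearMap.ker (mulX M i) := by
    ext m
    simp only [hPn, hP'n, Submodule.mem_inf, Submodule.restrictScalars_mem, hP',
      LinearMap.mem_ker, mulX_apply]
    constructor
    · rintro ⟨⟨⟨h1, h2⟩, h3⟩, h4⟩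
      exact ⟨⟨h1, h3⟩, h4⟩
    · rintro ⟨⟨h1, h3⟩, h4⟩
      exact ⟨⟨⟨h1, by rw [h4]; exact zero_mem _⟩, h3⟩, h4⟩
  have k2 : Pn.map (mulX M i) ⊓ Qn = P'n.map (mulX M i) := by
    ext m
    simp only [hPn, hP'n, hQn, Submodule.mem_inf, Submodule.restrictScalars_mem, hP',
      Submodule.mem_map, mulX_apply]
    constructor
    · rintro ⟨⟨y, ⟨h1, h2⟩, rfl⟩, h3, h4⟩
      exact ⟨y, ⟨⟨h1, h3⟩, h2⟩, rfl⟩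
    · rintro ⟨y, ⟨⟨h1, h3⟩, h2⟩, rfl⟩
      exact ⟨⟨y, ⟨h1, h2⟩, rfl⟩, h3, H.smul_mem i n y h2⟩
  have k3 : Pn.map (mulX M i) ⊔ Qn = Q'n := by
    apply le_antisymm
    · rw [sup_le_iff]
      constructor
      · rintro _ ⟨y, ⟨h1, h2⟩, rfl⟩
        refine ⟨?_, H.smul_mem i n y h2⟩
        change _ ∈ Q'
        rw [hQ']
        exact Submodule.mem_sup_right ⟨y, h1, rfl⟩
      · refine inf_le_inf_right _ ?_
        intro m hm
        change m ∈ Q'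
        rw [hQ']
        exact Submodule.mem_sup_left hm
    · rintro m ⟨h1, h2⟩
      change m ∈ Q' at h1
      rw [hQ'] at h1
      obtain ⟨q, hq, _, ⟨p, hp, rfl⟩, hqp⟩ := Submodule.mem_sup.1 h1
      have : m = (X i : MvPolynomial ι ℚ) • π n p + π (n + d i) q := by
        rw [← H.same _ m h2, ← hqp, map_add, LinearMap.lsmul_apply, H.smul, add_comm]
      rw [this]
      exact Submodule.add_mem_sup ⟨π n p, ⟨hP n p hp, H.mem _ _⟩, rfl⟩ ⟨hQ _ _ hq, H.mem _ _⟩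
  rw [k1] at e2
  rw [k2, k3] at e3
  have e1' := congrArg (Nat.cast : ℕ → ℚ) e1
  have e2' := congrArg (Nat.cast : ℕ → ℚ) e2
  have e3' := congrArg (Nat.cast : ℕ → ℚ) e3
  push_cast at e1' e2' e3'
  simp only [hilb]
  linarith

lemma hilb_qpoly (H : GrData d 𝒩 π) [IsNoetherian (MvPolynomial ι ℚ) M] [DecidableEq ι]
    (T : ℕ) (hT : 0 < T) (hdT : ∀ i, d i ∣ (T : ℤ)) (s : Finset ι) :
    ∀ (P Q : Submodule (MvPolynomial ι ℚ) M), Q ≤ P →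
    (∀ n, ∀ p ∈ P, π n p ∈ P) → (∀ n, ∀ p ∈ Q, π n p ∈ Q) →
    (∀ i, i ∉ s → ∀ p ∈ P, (X i : MvPolynomial ι ℚ) • p ∈ Q) →
    QPoly T s.card (fun n => hilb 𝒩 P n - hilb 𝒩 Q n) := by
  induction s using Finset.induction_on with
  | empty =>
    intro P Q hQP hP hQ hk
    obtain ⟨G, hG⟩ := IsNoetherian.noetherian P
    have h1 := le_sup_span (G : Set M) Q (by
      intro i p hp
      rw [hG] at hp
      exact hk i (by simp) p hp)
    choose N hN using H.ev
    obtain ⟨N₀, hN₀⟩ : ∃ N₀ : ℤ, ∀ g ∈ G, N g ≤ N₀ := by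
      obtain ⟨b, hb⟩ := (G.image N).bddAbove
      exact ⟨b, fun g hg => hb (by simpa using ⟨g, hg, rfl⟩)⟩
    refine QPoly.zero.congr_ev N₀ fun n hn => ?_
    have hker : Submodule.span ℚ (G : Set M) ≤ LinearMap.ker (π n) := by
      rw [Submodule.span_le]
      intro g hg
      exact hN g n ((hN₀ g hg).trans hn)
    have : (P.restrictScalars ℚ ⊓ 𝒩 n : Submodule ℚ M) = Q.restrictScalars ℚ ⊓ 𝒩 n := by
      apply le_antisymm
      · rintro m ⟨hm1, hm2⟩
        refine ⟨?_, hm2⟩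
        rw [hG] at h1
        obtain ⟨q, hq, g, hg, hqg⟩ := Submodule.mem_sup.1 (h1 hm1)
        have hg0 : π n g = 0 := hker hg
        rw [← H.same n m hm2, ← hqg, map_add, hg0, add_zero]
        exact hQ n q hq
      · exact inf_le_inf_right _ hQP
    have h2 : hilb 𝒩 P n = hilb 𝒩 Q n :=
      congrArg (fun W : Submodule ℚ M => (Module.finrank ℚ W : ℚ)) this
    simp [h2]
  | insert i s his ih =>
    intro P Q hQP hP hQ hk
    let P' : Submodule (MvPolynomial ι ℚ) M :=
      P ⊓ Q.comap (LinearMap.lsmul (MvPolynomial ι ℚ) M (X i))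
    have hP' : ∀ m, m ∈ P' ↔ m ∈ P ∧ (X i : MvPolynomial ι ℚ) • m ∈ Q := fun m => Iff.rfl
    let Q' := Q ⊔ P.map (LinearMap.lsmul (MvPolynomial ι ℚ) M (X i))
    have q1 := ih P' Q
      (fun m hm => ⟨hQP hm, Q.smul_mem _ hm⟩)
      (by
        rintro n p hp
        rw [hP'] at hp ⊢
        refine ⟨hP n p hp.1, ?_⟩
        rw [← H.smul]
        exact hQ _ _ hp.2) hQ
      (by
        intro j hj p hp
        rw [hP'] at hp
        by_cases hji : j = i
        · rw [hji]; exact hp.2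
        · exact hk j (by simp [hji, hj]) p hp.1)
    have q2 := ih P Q'
      (sup_le hQP (by
        rintro _ ⟨p, hp, rfl⟩
        exact P.smul_mem _ hp)) hP
      (by
        intro n m hm
        obtain ⟨q, hq, _, ⟨p, hp, rfl⟩, rfl⟩ := Submodule.mem_sup.1 hm
        rw [map_add, LinearMap.lsmul_apply, H.smul']
        exact Submodule.add_mem_sup (hQ n q hq) ⟨_, hP _ p hp, rfl⟩)
      (by
        intro j hj p hp
        by_cases hji : j = i
        · rw [hji]; exact Submodule.mem_sup_right ⟨p, hp, rfl⟩
        · exact Submodule.mem_sup_left (hk j (by simp [hji, hj]) p hp))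
    rw [Finset.card_insert_of_notMem his]
    refine QPoly.of_diff hT (d i) (H.pos i) (hdT i) ?_
    refine ((q2.shift (d i)).add q1.neg).congr_ev 0 fun n _ => ?_
    have := H.hilb_step i P Q P' Q' hP hQ hP' rfl n
    linarith

lemma main (H : GrData d 𝒩 π) [IsNoetherian (MvPolynomial ι ℚ) M] [Fintype ι]
    (T : ℕ) (hT : 0 < T) (hdT : ∀ i, d i ∣ (T : ℤ)) :
    QPoly T (Fintype.card ι) (fun n => (Module.finrank ℚ (𝒩 n) : ℚ)) := by
  classical
  have := H.hilb_qpoly T hT hdT Finset.univ ⊤ ⊥ bot_le (by simp) (by simp) (by simp)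
  refine this.congr_ev 0 fun n _ => ?_
  have h1 : hilb 𝒩 (⊤ : Submodule (MvPolynomial ι ℚ) M) n = Module.finrank ℚ (𝒩 n) :=
    congrArg (fun W : Submodule ℚ M => (Module.finrank ℚ W : ℚ)) (by simp)
  have h2 : hilb 𝒩 (⊥ : Submodule (MvPolynomial ι ℚ) M) n
      = Module.finrank ℚ (⊥ : Submodule ℚ M) :=
    congrArg (fun W : Submodule ℚ M => (Module.finrank ℚ W : ℚ)) (by simp)
  rw [finrank_bot] at h2
  simp [h1, h2]

end GrData

/-- Adjoining anticommuting operators keeps finite generation. -/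
lemma exists_fg_stable {R M κ : Type} [CommRing R] [AddCommGroup M] [Module R M] [Module ℚ M]
    (o : κ → M →ₗ[R] M) (hanti : ∀ i j m, o i (o j m) = - o j (o i m)) (s : Finset κ)
    (N₀ : Submodule R M) (h0 : N₀.FG) :
    ∃ N : Submodule R M, N.FG ∧ N₀ ≤ N ∧ ∀ i ∈ s, ∀ m ∈ N, o i m ∈ N := by
  classical
  induction s using Finset.induction_on with
  | empty => exact ⟨N₀, h0, le_rfl, by simp⟩
  | insert i s his ih =>
    obtain ⟨N, hN, hle, hst⟩ := ih
    refine ⟨N ⊔ N.map (o i), hN.sup (hN.map _), hle.trans le_sup_left, ?_⟩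
    intro j hj m hm
    obtain ⟨y, hy, _, ⟨z, hz, rfl⟩, rfl⟩ := Submodule.mem_sup.1 hm
    have hii : o i (o i z) = 0 := by
      have h1 := hanti i i z
      have h2 : (2 : ℚ) • o i (o i z) = 0 := by
        rw [two_smul]; nth_rewrite 1 [h1]; simp
      simpa using h2
    rw [map_add]
    rcases Finset.mem_insert.1 hj with rfl | hj
    · rw [hii, add_zero]
      exact Submodule.mem_sup_right ⟨y, hy, rfl⟩
    · rw [hanti j i]
      exact Submodule.add_mem_sup (hst j hj y hy) (neg_mem ⟨_, hst j hj z hz, rfl⟩)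

end Graded

section GSymFacts

variable {V}

/-- the quotient map onto `GSym V` -/
noncomputable def GSym.mk : TensorAlgebra ℚ (⨁ p, V p) →ₐ[ℚ] GSym V :=
  RingQuot.mkAlgHom ℚ (GSymRel V)

lemma GSym.mk_surjective : Function.Surjective (GSym.mk (V := V)) :=
  RingQuot.mkAlgHom_surjective ℚ (GSymRel V)

/-- `gen` as a linear map -/
noncomputable def GSym.genL (p : ℤ × ℤ) : V p →ₗ[ℚ] GSym V :=
  (GSym.mk (V := V)).toLinearMap ∘ₗ TensorAlgebra.ι ℚ ∘ₗ DirectSum.lof ℚ (ℤ × ℤ) V p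

lemma GSym.genL_apply (p : ℤ × ℤ) (x : V p) : GSym.genL p x = GSym.gen V p x := rfl

lemma GSym.ind {motive : GSym V → Prop} (alg : ∀ c : ℚ, motive (algebraMap ℚ (GSym V) c))
    (gen : ∀ p x, motive (GSym.gen V p x))
    (add : ∀ x y, motive x → motive y → motive (x + y))
    (mul : ∀ x y, motive x → motive y → motive (x * y)) (x : GSym V) : motive x := by
  obtain ⟨t, rfl⟩ := GSym.mk_surjective x
  induction t using TensorAlgebra.induction with
  | algebraMap r => rw [AlgHom.commutes]; exact alg r
  | ι v =>
    induction v using DirectSum.induction_on with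
    | zero => simpa using alg 0
    | of p x => exact gen p x
    | add x y hx hy => rw [map_add, map_add]; exact add _ _ hx hy
  | mul a b ha hb => rw [map_mul]; exact mul _ _ ha hb
  | add a b ha hb => rw [map_add]; exact add _ _ ha hb

lemma GSym.gen_comm (p q : ℤ × ℤ) (x : V p) (y : V q) :
    GSym.gen V p x * GSym.gen V q y =
      ((-1 : ℚ) ^ (p.2 * q.2)) • (GSym.gen V q y * GSym.gen V p x) := by
  have h := RingQuot.mkAlgHom_rel ℚ (GSymRel.comm p q x y)
  have h' : (GSym.mk (V := V)) _ = GSym.mk (V := V) _ := h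
  rw [map_smul, map_mul, map_mul] at h'
  exact h'

lemma GSym.gen_mem_center (p : ℤ × ℤ) (hp : Even p.2) (x : V p) :
    GSym.gen V p x ∈ Subalgebra.center ℚ (GSym V) := by
  rw [Subalgebra.mem_center_iff]
  intro y
  induction y using GSym.ind with
  | alg c => exact Algebra.commutes c _
  | gen q y =>
    have h := GSym.gen_comm q p y x
    rw [(hp.mul_left q.2).neg_one_zpow, one_smul] at h
    exact h
  | add y z hy hz => rw [add_mul, mul_add, hy, hz]
  | mul y z hy hz => rw [mul_assoc, hz, ← mul_assoc, hy, mul_assoc]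

lemma GSym.gen_anticomm (p q : ℤ × ℤ) (hp : ¬ Even p.2) (hq : ¬ Even q.2) (x : V p) (y : V q) :
    GSym.gen V p x * GSym.gen V q y = - (GSym.gen V q y * GSym.gen V p x) := by
  have h := GSym.gen_comm p q x y
  rw [Int.not_even_iff_odd] at hp hq
  rw [(hp.mul hq).neg_one_zpow, neg_smul, one_smul] at h
  exact h

lemma GSym.gen_mem_grade (p : ℤ × ℤ) (x : V p) : GSym.gen V p x ∈ GSym.grade V p :=
  Submodule.subset_span ⟨[⟨p, x⟩], by simp, by simp⟩

variable {M : Type} [AddCommGroup M] [Module ℚ M] [Module (GSym V) M] [IsScalarTower ℚ (GSym V) M]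

lemma GSym.stable (W : Submodule ℚ M) (h : ∀ p x, ∀ m ∈ W, GSym.gen V p x • m ∈ W)
    (x : GSym V) : ∀ m ∈ W, x • m ∈ W := by
  induction x using GSym.ind with
  | alg c => intro m hm; rw [algebraMap_smul]; exact W.smul_mem c hm
  | gen p x => exact h p x
  | add x y hx hy => intro m hm; rw [add_smul]; exact W.add_mem (hx m hm) (hy m hm)
  | mul x y hx hy => intro m hm; rw [mul_smul]; exact hx _ (hy m hm)

end GSymFacts

lemma slope_aux (p : ℤ × ℤ) (C : ℚ) (a b : ℤ) (ha : 0 < a) (hab : Int.gcd a b = 1)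
    (hC : (b : ℚ) / (a : ℚ) = C) (hp : 0 < p.1) (hs : (p.2 : ℚ) / (p.1 : ℚ) = C) :
    ∃ k : ℕ, p = (a * k, b * k) := by
  have ha' : (a : ℚ) ≠ 0 := by exact_mod_cast ha.ne'
  have hp' : (p.1 : ℚ) ≠ 0 := by exact_mod_cast hp.ne'
  rw [← hC, div_eq_div_iff hp' ha'] at hs
  have hs' : p.2 * a = b * p.1 := by exact_mod_cast hs
  have hdvd : a ∣ p.1 := by
    apply Int.dvd_of_dvd_mul_right_of_gcd_one (b := b) _ hab
    exact ⟨p.2, by linarith⟩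
  obtain ⟨k, hk⟩ := hdvd
  have hk0 : 0 ≤ k := by
    by_contra hneg
    push Not at hneg
    nlinarith
  lift k to ℕ using hk0
  refine ⟨k, Prod.ext hk ?_⟩
  rw [hk] at hs'
  have : a * p.2 = a * (b * k) := by linarith
  exact mul_left_cancel₀ ha.ne' this

lemma exists_proj {I M : Type} [DecidableEq I] [AddCommGroup M] [Module ℚ M]
    (Mgr : I → Submodule ℚ M) (hdec : DirectSum.IsInternal Mgr) :
    ∃ π : I → M →ₗ[ℚ] M, (∀ p m, π p m ∈ Mgr p) ∧ (∀ p m, m ∈ Mgr p → π p m = m) ∧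
      (∀ p q m, m ∈ Mgr p → p ≠ q → π q m = 0) := by
  letI := hdec.chooseDecomposition
  refine ⟨fun p => (Mgr p).subtype ∘ₗ DirectSum.component ℚ I (fun p => Mgr p) p ∘ₗ
    (DirectSum.decomposeLinearEquiv Mgr).toLinearMap, ?_, ?_, ?_⟩
  · intro p m; simp
  · intro p m hm
    exact DirectSum.decompose_of_mem_same Mgr hm
  · intro p q m hm hpq
    exact DirectSum.decompose_of_mem_ne Mgr hm hpq

lemma internal_ind {I M : Type} [DecidableEq I] [AddCommGroup M] [Module ℚ M]
    (Mgr : I → Submodule ℚ M) (hdec : DirectSum.IsInternal Mgr) {motive : M → Prop}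
    (zero : motive 0) (hom : ∀ p, ∀ m ∈ Mgr p, motive m)
    (add : ∀ x y, motive x → motive y → motive (x + y)) (m : M) : motive m := by
  have : m ∈ ⨆ p, Mgr p := by rw [hdec.submodule_iSup_eq_top]; trivial
  exact Submodule.iSup_induction Mgr (motive := motive) this hom zero add

theorem finitely_generated_growth
    (C : ℚ)
    (hft : Bigraded.FiniteType V)
    -- `S` is the (finite) support of `V`, so that `V` is finite dimensional:
    (S : Finset (ℤ × ℤ)) (hS : ∀ p, p ∈ S ↔ Nontrivial (V p))
    (hfq : Bigraded.FirstQuadrant V)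
    (hslope : Bigraded.OfSlope V C)
    -- `M`, a bigraded `Sym(V)`-module:
    (M : Type) [AddCommGroup M] [Module ℚ M] [Module (GSym V) M]
    [IsScalarTower ℚ (GSym V) M]
    (Mgr : ℤ × ℤ → Submodule ℚ M) (hdec : DirectSum.IsInternal Mgr)
    (hcompat : ∀ (p q : ℤ × ℤ) (a : GSym V) (m : M),
      a ∈ GSym.grade V p → m ∈ Mgr q → a • m ∈ Mgr (p + q))
    -- finitely generated by bihomogeneous elements:
    (hfg : ∃ G : Finset M, (∀ m ∈ G, ∃ p, m ∈ Mgr p) ∧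
      Submodule.span (GSym V) (G : Set M) = ⊤)
    -- a ray of slope `C = b/a` in `M`, with offset `i₀`:
    (a b i₀ : ℤ) (ha : 0 < a) (hab : Int.gcd a b = 1) (hC : (b : ℚ) / (a : ℚ) = C) :
    -- the ray is a `Sym(V)`-submodule:
    (∀ (x : GSym V) (m : M), m ∈ (⨆ u : ℕ, Mgr (a * u, b * u + i₀)) →
      x • m ∈ (⨆ u : ℕ, Mgr (a * u, b * u + i₀))) ∧
    -- and its graded dimension is eventually a quasi-polynomial of period dividing
    -- `lcm(V⁰)` and degree at most `dim V⁰ - 1`: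
    ∃ T : ℕ, 0 < T ∧
      (T : ℤ) ∣ ((S.filter fun p => Even p.2).image Prod.fst).lcm id ∧
      ∃ P : ZMod T → Polynomial ℚ,
        (∀ j, (P j).degree <
          (((S.filter fun p => Even p.2).sum fun p => Module.finrank ℚ (V p)) : WithBot ℕ)) ∧
        ∃ N : ℤ, ∀ n : ℤ, N ≤ n →
          ((if a ∣ n ∧ 0 ≤ n then Module.finrank ℚ (Mgr (n, b * (n / a) + i₀)) else 0 : ℕ) : ℚ)
            = (P (n : ZMod T)).eval (n : ℚ) := by
  classical
  -- basic facts on the support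
  have hpos : ∀ p ∈ S, 0 < p.1 := by
    intro p hp
    have hnt := (hS p).1 hp
    have h1 := (hslope p hnt).1
    have h2 : ¬ p.1 < 0 := fun h => not_subsingleton_iff_nontrivial.2 hnt (hfq p (Or.inl h))
    omega
  have hray : ∀ p ∈ S, ∃ k : ℕ, p = (a * k, b * k) := fun p hp =>
    slope_aux p C a b ha hab hC (hpos p hp) (hslope p ((hS p).1 hp)).2
  have hzero : ∀ p, p ∉ S → ∀ x : V p, x = 0 := by
    intro p hp x
    rw [hS, not_nontrivial_iff_subsingleton] at hp
    exact Subsingleton.elim _ _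
  have hgen0 : ∀ p, GSym.gen V p 0 = 0 := fun p => (GSym.genL (V := V) p).map_zero
  constructor
  · intro x m hm
    refine GSym.stable (V := V) (⨆ u : ℕ, Mgr (a * u, b * u + i₀)) ?_ x m hm
    intro p y m hm
    by_cases hp : p ∈ S
    · obtain ⟨k, hk⟩ := hray p hp
      refine Submodule.iSup_induction _ (motive := fun m => GSym.gen V p y • m ∈
        (⨆ u : ℕ, Mgr (a * u, b * u + i₀))) hm ?_ ?_ ?_
      · intro u m hm
        have h := hcompat p _ _ m (GSym.gen_mem_grade p y) hm
        have he : p + (a * (u : ℤ), b * (u : ℤ) + i₀)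
            = (a * ((k + u : ℕ) : ℤ), b * ((k + u : ℕ) : ℤ) + i₀) := by
          rw [hk]
          ext
          · simp; ring
          · simp; ring
        rw [he] at h
        exact Submodule.mem_iSup_of_mem (k + u) h
      · rw [smul_zero]; exact zero_mem _
      · intro x y hx hy
        rw [smul_add]; exact add_mem hx hy
    · rw [hzero p hp y, hgen0, zero_smul]
      exact zero_mem _
  -- the even and odd index sets
  have hfd : ∀ p, FiniteDimensional ℚ (V p) := hft
  let ι := Σ p : {p : ℤ × ℤ // p ∈ S.filter fun p => Even p.2}, Fin (Module.finrank ℚ (V p))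
  let κ := Σ p : {p : ℤ × ℤ // p ∈ S.filter fun p => ¬ Even p.2}, Fin (Module.finrank ℚ (V p))
  let β : ∀ p, Module.Basis (Fin (Module.finrank ℚ (V p))) ℚ (V p) :=
    fun p => Module.finBasis ℚ (V p)
  let e : ι → GSym V := fun i => GSym.gen V i.1 (β i.1 i.2)
  let o : κ → GSym V := fun i => GSym.gen V i.1 (β i.1 i.2)
  have heven : ∀ i : ι, (i.1 : ℤ × ℤ) ∈ S ∧ Even (i.1 : ℤ × ℤ).2 := fun i =>
    Finset.mem_filter.1 i.1.2
  have hodd : ∀ i : κ, (i.1 : ℤ × ℤ) ∈ S ∧ ¬ Even (i.1 : ℤ × ℤ).2 := fun i =>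
    Finset.mem_filter.1 i.1.2
  have hec : ∀ i, e i ∈ Subalgebra.center ℚ (GSym V) := fun i =>
    GSym.gen_mem_center _ (heven i).2 _
  let ψ : MvPolynomial ι ℚ →ₐ[ℚ] Subalgebra.center ℚ (GSym V) :=
    MvPolynomial.aeval fun i => ⟨e i, hec i⟩
  let φ : MvPolynomial ι ℚ →ₐ[ℚ] GSym V := (Subalgebra.val _).comp ψ
  have hφX : ∀ i, φ (MvPolynomial.X i) = e i := by
    intro i
    simp [φ, ψ]
  have hφc : ∀ r x, x * φ r = φ r * x := fun r x =>
    (Subalgebra.mem_center_iff.1 (ψ r).2) x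
  letI : Module (MvPolynomial ι ℚ) M := Module.compHom M φ.toRingHom
  have hsm : ∀ (r : MvPolynomial ι ℚ) (m : M), r • m = φ r • m := fun r m => rfl
  have hXsm : ∀ (i : ι) (m : M), (MvPolynomial.X i : MvPolynomial ι ℚ) • m = e i • m := by
    intro i m; rw [hsm, hφX]
  haveI : IsScalarTower ℚ (MvPolynomial ι ℚ) M := ⟨fun c r m => by
    rw [hsm, hsm, map_smul, smul_assoc]⟩
  -- finite generation over the polynomial ring
  have hfin : IsNoetherian (MvPolynomial ι ℚ) M := by
    obtain ⟨G, -, hG⟩ := hfg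
    let oL : κ → M →ₗ[MvPolynomial ι ℚ] M := fun k =>
      { toFun := fun m => o k • m
        map_add' := fun x y => smul_add _ _ _
        map_smul' := fun r m => by
          simp only [RingHom.id_apply, hsm, ← mul_smul, hφc] }
    have hanti : ∀ i j m, oL i (oL j m) = - oL j (oL i m) := by
      intro i j m
      change o i • o j • m = - (o j • o i • m)
      rw [← mul_smul, ← mul_smul, ← neg_smul]
      congr 1
      exact GSym.gen_anticomm _ _ (hodd i).2 (hodd j).2 _ _
    obtain ⟨N, hN, hle, hst⟩ := exists_fg_stable oL hanti Finset.univ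
      (Submodule.span (MvPolynomial ι ℚ) (G : Set M)) ⟨G, rfl⟩
    have hgen : ∀ p x, ∀ m ∈ N.restrictScalars ℚ, GSym.gen V p x • m ∈ N.restrictScalars ℚ := by
      intro p x m hm
      by_cases hp : p ∈ S
      · rw [← (β p).sum_repr x, ← GSym.genL_apply, map_sum, Finset.sum_smul]
        refine Submodule.sum_mem _ fun j _ => ?_
        rw [map_smul, smul_assoc]
        refine Submodule.smul_mem _ _ ?_
        rw [GSym.genL_apply]
        by_cases hev : Even p.2
        · have := hXsm ⟨⟨p, Finset.mem_filter.2 ⟨hp, hev⟩⟩, j⟩ m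
          have h2 : e ⟨⟨p, Finset.mem_filter.2 ⟨hp, hev⟩⟩, j⟩ • m ∈ N := by
            rw [← this]; exact N.smul_mem _ hm
          exact h2
        · exact hst ⟨⟨p, Finset.mem_filter.2 ⟨hp, hev⟩⟩, j⟩ (Finset.mem_univ _) m hm
      · rw [hzero p hp x, hgen0, zero_smul]
        exact zero_mem _
    have hall := GSym.stable (V := V) (N.restrictScalars ℚ) hgen
    have htop : N = ⊤ := by
      rw [eq_top_iff]
      intro m _
      have hm : m ∈ Submodule.span (GSym V) (G : Set M) := by rw [hG]; trivial
      induction hm using Submodule.span_induction with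
      | mem x hx => exact hle (Submodule.subset_span hx)
      | zero => exact zero_mem _
      | add x y _ _ hx hy => exact add_mem (hx trivial) (hy trivial)
      | smul r x _ hx => exact hall r x (hx trivial)
    have : Module.Finite (MvPolynomial ι ℚ) M := ⟨htop ▸ hN⟩
    exact isNoetherian_of_isNoetherianRing_of_finite _ _
  -- the graded structure
  obtain ⟨pr, hpr1, hpr2, hpr3⟩ := exists_proj Mgr hdec
  have hprs : ∀ (i : ι) q m, pr ((i.1 : ℤ × ℤ) + q) (e i • m) = e i • pr q m := by
    intro i q m
    induction m using internal_ind Mgr hdec with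
    | zero => simp
    | hom p m hm =>
      have h1 := hcompat _ p _ m (GSym.gen_mem_grade (i.1 : ℤ × ℤ) (β i.1 i.2)) hm
      by_cases hpq : p = q
      · subst hpq
        rw [hpr2 p m hm]
        exact hpr2 _ _ h1
      · rw [hpr3 p q m hm hpq, smul_zero]
        exact hpr3 _ _ _ h1 (fun h => hpq (add_left_cancel h))
    | add x y hx hy => rw [smul_add, map_add, map_add, smul_add, hx, hy]
  have hprev : ∀ m, ∃ N : ℤ, ∀ n j : ℤ, N ≤ n → pr (n, j) m = 0 := by
    intro m
    induction m using internal_ind Mgr hdec with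
    | zero => exact ⟨0, by simp⟩
    | hom p m hm =>
      refine ⟨p.1 + 1, fun n j hn => hpr3 p _ m hm ?_⟩
      rintro rfl
      simp at hn
    | add x y hx hy =>
      obtain ⟨N, hN⟩ := hx
      obtain ⟨N', hN'⟩ := hy
      refine ⟨max N N', fun n j hn => ?_⟩
      rw [map_add, hN n j (le_trans (le_max_left _ _) hn),
        hN' n j (le_trans (le_max_right _ _) hn), add_zero]
  let 𝒩 : ℤ → Submodule ℚ M := fun n => if a ∣ n then Mgr (n, b * (n / a) + i₀) else ⊥
  let π : ℤ → M →ₗ[ℚ] M := fun n => if a ∣ n then pr (n, b * (n / a) + i₀) else 0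
  let d : ι → ℤ := fun i => (i.1 : ℤ × ℤ).1
  have H : GrData d 𝒩 π := by
    refine ⟨?_, ?_, ?_, ?_, ?_, ?_⟩
    · intro n m
      by_cases h : a ∣ n
      · simp only [𝒩, π, if_pos h]; exact hpr1 _ _
      · simp only [𝒩, π, if_neg h]; simp
    · intro n m hm
      by_cases h : a ∣ n
      · simp only [𝒩, π, if_pos h] at hm ⊢; exact hpr2 _ _ hm
      · simp only [𝒩, π, if_neg h] at hm ⊢
        rw [Submodule.mem_bot] at hm
        simp [hm]
    · intro n n' m hm hne
      by_cases h' : a ∣ n'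
      · by_cases h : a ∣ n
        · simp only [𝒩, π, if_pos h, if_pos h'] at hm ⊢
          refine hpr3 _ _ _ hm fun heq => hne (congrArg Prod.fst heq).symm
        · simp only [𝒩, if_neg h] at hm
          rw [Submodule.mem_bot] at hm
          simp [hm]
      · simp only [π, if_neg h']; simp
    · intro i n m
      rw [hXsm, hXsm]
      obtain ⟨k, hk⟩ := hray _ (heven i).1
      have hdi : d i = a * k := congrArg Prod.fst hk
      by_cases h : a ∣ n
      · have h' : a ∣ n + d i := dvd_add h ⟨k, hdi⟩
        simp only [π, if_pos h, if_pos h']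
        rw [← hprs]
        congr 2
        rw [hk, hdi, Int.add_mul_ediv_left _ _ ha.ne']
        ext
        · simp; ring
        · simp; ring
      · have h' : ¬ a ∣ n + d i := by
          rw [hdi]
          intro h''
          exact h ((Int.dvd_add_left (Dvd.intro _ rfl)).1 h'')
        simp only [π, if_neg h, if_neg h']
        simp
    · intro m
      obtain ⟨N, hN⟩ := hprev m
      refine ⟨N, fun n hn => ?_⟩
      by_cases h : a ∣ n
      · simp only [π, if_pos h]; exact hN _ _ hn
      · simp only [π, if_neg h]; simp
    · intro i
      exact hpos _ (heven i).1
  -- the period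
  set L : ℤ := ((S.filter fun p => Even p.2).image Prod.fst).lcm id with hL
  have hL0 : L ≠ 0 := by
    rw [hL, Ne, Finset.lcm_eq_zero_iff]
    simp only [Set.mem_image, id]
    rintro ⟨x, hx, rfl⟩
    obtain ⟨p, hp, hp0⟩ := Finset.mem_image.1 hx
    have := hpos p (Finset.mem_filter.1 hp).1
    omega
  have hLT : 0 < L.natAbs := Int.natAbs_pos.2 hL0
  have hq := H.main L.natAbs hLT (by
    intro i
    rw [Int.dvd_natAbs]
    exact Finset.dvd_lcm (f := id) (Finset.mem_image_of_mem Prod.fst i.1.2))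
  refine ⟨L.natAbs, hLT, Int.natAbs_dvd.2 dvd_rfl, ?_⟩
  have hcard : Fintype.card ι = (S.filter fun p => Even p.2).sum fun p =>
      Module.finrank ℚ (V p) := by
    simp only [ι, Fintype.card_sigma, Fintype.card_fin]
    exact Finset.sum_coe_sort (S.filter fun p => Even p.2) (fun p => Module.finrank ℚ (V p))
  obtain ⟨P, hP, N, hN⟩ := hq
  refine ⟨P, fun j => ?_, max N 0, fun n hn => ?_⟩
  · have := hP j
    rw [hcard] at this
    exact_mod_cast this
  · rw [← hN n (le_trans (le_max_left _ _) hn)]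
    have hn0 : 0 ≤ n := le_trans (le_max_right _ _) hn
    by_cases h : a ∣ n
    · rw [if_pos ⟨h, hn0⟩]
      exact (congrArg (fun W : Submodule ℚ M => (Module.finrank ℚ W : ℚ)) (if_pos h)).symm
    · rw [if_neg (fun h' => h h'.1)]
      have h0 : (Module.finrank ℚ (𝒩 n) : ℚ) = Module.finrank ℚ (⊥ : Submodule ℚ M) :=
        congrArg (fun W : Submodule ℚ M => (Module.finrank ℚ W : ℚ)) (if_neg h)
      rw [finrank_bot] at h0
      exact h0.symm
end

section
/- Let m ≥ 0 and let M be a finitely generated module over the polynomial ring R = ℚ[x₁,…,x_m]. Suppose M carries ℚ-linear endomorphisms D₁,…,D_m satisfying D_i ∘ D_j = D_j ∘ D_i for all i,j and the Weyl relation D_i(x_j · v) = x_j · D_i(v) + δ_{ij} v for all v ∈ M and all i,j (that is, the R-module structure on M extends to a module structure over the Weyl algebra on m generators). Then M is a free R-module. -/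
namespace WeylFree
open MvPolynomial

/-- D-stable nonzero ideals of a polynomial ring are everything. -/
theorem stable_ideal_eq_top {m : ℕ} (J : Ideal (MvPolynomial (Fin m) ℚ))
    (hJ : ∀ i, ∀ f ∈ J, pderiv i f ∈ J) (hne : ∃ f ∈ J, f ≠ 0) : (1 : MvPolynomial (Fin m) ℚ) ∈ J := by
  obtain ⟨f, hf, hf0⟩ := hne
  induction hd : f.totalDegree using Nat.strong_induction_on generalizing f with
  | _ d ih =>
    by_cases h : ∃ i, pderiv i f ≠ 0
    · obtain ⟨i, hi⟩ := h
      refine ih _ ?_ (pderiv i f) (hJ i f hf) hi rfl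
      subst hd
      obtain ⟨s, hs⟩ := support_nonempty.mpr hi
      have hlt : ∀ s ∈ (pderiv i f).support, (s.sum fun _ e => e) < f.totalDegree := by
        intro s hs
        have h2 : coeff (s + Finsupp.single i 1) f ≠ 0 := by
          intro h0
          apply mem_support_iff.mp hs
          rw [coeff_pderiv, h0, zero_mul]
        have h3 := le_totalDegree (mem_support_iff.mpr h2)
        rw [Finsupp.sum_add_index' (by simp) (by simp), Finsupp.sum_single_index rfl] at h3
        omega
      rw [totalDegree, Finset.sup_lt_iff (lt_of_le_of_lt bot_le (hlt s hs))]
      exact hlt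
    · push Not at h
      have hc : f = C (coeff 0 f) := by
        ext s
        rw [coeff_C]
        split_ifs with h0
        · rw [h0]
        · obtain ⟨i, hi⟩ : ∃ i, s i ≠ 0 := by
            by_contra! hh
            exact h0 (Finsupp.ext fun i => (hh i).symm)
          have h1 := congrArg (coeff (s - Finsupp.single i 1)) (h i)
          have h2 : s - Finsupp.single i 1 + Finsupp.single i 1 = s :=
            tsub_add_cancel_of_le (by simpa using Nat.one_le_iff_ne_zero.mpr hi)
          rw [coeff_pderiv, h2, coeff_zero, mul_eq_zero] at h1
          rcases h1 with h1 | h1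
          · exact h1
          · exfalso
            norm_cast at h1
      have hc0 : coeff 0 f ≠ 0 := by
        intro h0; rw [h0, map_zero] at hc; exact hf0 hc
      have := J.mul_mem_left (C (coeff 0 f)⁻¹) hf
      rw [hc, ← map_mul, coeff_C, if_pos rfl, inv_mul_cancel₀ hc0, map_one] at this
      exact this

/-- Generic: over a domain some nonzero multiple of the identity factors through a free module. -/
theorem exists_smul_mem_range {R M : Type} [CommRing R] [IsDomain R] [AddCommGroup M] [Module R M]
    [Module.Finite R M] :
    ∃ f : R, f ≠ 0 ∧ f • (1 : M →ₗ[R] M) ∈ LinearMap.range (dualTensorHom R M M) := by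
  classical
  obtain ⟨n, v, hv⟩ := Module.Finite.exists_fin (R := R) (M := M)
  obtain ⟨s, hs, hmax⟩ := exists_maximal_linearIndepOn R v
  let N := Submodule.span R (Set.range fun i : s => v i)
  have hN : N = Submodule.span R (Set.image v s) := by
    simp only [N]; congr 1; ext x; simp
  have ha : ∀ i, ∃ a : R, a ≠ 0 ∧ a • v i ∈ N := by
    intro i
    by_cases hi : i ∈ s
    · exact ⟨1, one_ne_zero, by rw [one_smul]; exact Submodule.subset_span ⟨⟨i, hi⟩, rfl⟩⟩
    · rw [hN]; exact hmax i hi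
  choose a ha0 haN using ha
  let h := ∏ i, a i
  have hmem : ∀ x : M, h • x ∈ N := by
    have : ∀ x ∈ Submodule.span R (Set.range v), h • x ∈ N := by
      intro x hx
      induction hx using Submodule.span_induction with
      | mem x hx =>
        obtain ⟨i, rfl⟩ := hx
        simp only [h]
        rw [← Finset.prod_erase_mul _ _ (Finset.mem_univ i), mul_smul]
        exact N.smul_mem _ (haN i)
      | zero => simp
      | add x y _ _ hx hy => rw [smul_add]; exact N.add_mem hx hy
      | smul r x _ hx => rw [smul_comm]; exact N.smul_mem _ hx
    intro x
    exact this x (by rw [hv]; trivial)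
  let b : Module.Basis s R N := Module.Basis.span hs
  let g : M →ₗ[R] N := LinearMap.codRestrict N (h • LinearMap.id) hmem
  refine ⟨h, Finset.prod_ne_zero_iff.mpr fun i _ => ha0 i,
    ∑ i, (b.coord i ∘ₗ g) ⊗ₜ[R] (b i : M), ?_⟩
  ext x
  have := congrArg (fun y : N => (y : M)) (b.sum_repr (g x))
  simp only [Submodule.coe_sum, Submodule.coe_smul] at this
  simp only [map_sum, LinearMap.sum_apply, dualTensorHom_apply, LinearMap.comp_apply,
    Module.Basis.coord_apply, this]
  rfl

theorem projective_of_weyl (m : ℕ) (M : Type) [AddCommGroup M]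
    [Module ℚ M] [Module (MvPolynomial (Fin m) ℚ) M]
    [IsScalarTower ℚ (MvPolynomial (Fin m) ℚ) M]
    [hfg : Module.Finite (MvPolynomial (Fin m) ℚ) M]
    (D : Fin m → (M →ₗ[ℚ] M))
    (hweyl : ∀ (i j : Fin m) (v : M),
      D i ((MvPolynomial.X j : MvPolynomial (Fin m) ℚ) • v) =
        (MvPolynomial.X j : MvPolynomial (Fin m) ℚ) • D i v + (if i = j then v else 0)) :
    Module.Projective (MvPolynomial (Fin m) ℚ) M := by
  have key : ∀ i (f : MvPolynomial (Fin m) ℚ) (v : M), D i (f • v) = f • D i v + pderiv i f • v := by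
    intro i f
    induction f using MvPolynomial.induction_on with
    | C a =>
      intro v
      have : ∀ w : M, (C a : MvPolynomial (Fin m) ℚ) • w = a • w := fun w => by
        rw [← MvPolynomial.algebraMap_eq, algebraMap_smul]
      simp [this]
    | add p q hp hq =>
      intro v
      simp only [add_smul, map_add, hp, hq]; abel
    | mul_X p j hp =>
      intro v
      rw [mul_smul, hp, hweyl, smul_add, Derivation.leibniz, pderiv_X, add_smul, ← mul_smul]
      by_cases h : i = j
      · subst h
        simp only [↓reduceIte, Pi.single_eq_same, smul_eq_mul, mul_one, mul_smul,
          smul_comm p (X i : MvPolynomial (Fin m) ℚ),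
          smul_comm (pderiv i p) (X i : MvPolynomial (Fin m) ℚ)]
        abel
      · simp [h, mul_smul, Ne.symm h, smul_comm p (X j : MvPolynomial (Fin m) ℚ),
          smul_comm (pderiv i p) (X j : MvPolynomial (Fin m) ℚ)]
  let R := MvPolynomial (Fin m) ℚ
  let J : Ideal R := (LinearMap.range (dualTensorHom R M M)).comap (LinearMap.toSpanSingleton R _ (1 : M →ₗ[R] M))
  have hJ : ∀ f : R, f ∈ J ↔ f • (1 : M →ₗ[R] M) ∈ LinearMap.range (dualTensorHom R M M) := fun f => Iff.rfl
  apply Module.Projective.of_one_mem_range_dualTensorHom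
  have h1 : (1 : R) ∈ J := by
    apply stable_ideal_eq_top
    · intro i f hf
      rw [hJ] at hf ⊢
      have gen : ∀ T ∈ LinearMap.range (dualTensorHom R M M), ∃ T' ∈ LinearMap.range (dualTensorHom R M M),
          ∀ v, T' v = D i (T v) - T (D i v) := by
        rintro _ ⟨x, rfl⟩
        induction x with
        | zero => exact ⟨0, zero_mem _, by simp⟩
        | add x y hx hy =>
          obtain ⟨a, ha, ha'⟩ := hx
          obtain ⟨b, hb, hb'⟩ := hy
          refine ⟨a + b, add_mem ha hb, fun v => ?_⟩
          simp only [map_add, LinearMap.add_apply, ha', hb']; abel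
        | tmul φ s =>
          let ψ : Module.Dual R M :=
            { toFun := fun v => pderiv i (φ v) - φ (D i v)
              map_add' := fun v w => by simp only [map_add]; abel
              map_smul' := fun r v => by
                simp only [map_smul, key, map_add, smul_eq_mul, Derivation.leibniz, RingHom.id_apply]
                ring }
          refine ⟨dualTensorHom R M M (ψ ⊗ₜ s + φ ⊗ₜ D i s), ⟨_, rfl⟩, fun v => ?_⟩
          have hψ : ψ v = pderiv i (φ v) - φ (D i v) := rfl
          simp only [map_add, LinearMap.add_apply, dualTensorHom_apply, key, hψ, sub_smul]
          abel
      obtain ⟨T', hT', h⟩ := gen _ hf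
      convert hT' using 1
      ext v
      rw [h]
      simp [key]
    · obtain ⟨f, hf, h⟩ := exists_smul_mem_range (R := R) (M := M)
      exact ⟨f, h, hf⟩
  rw [hJ, one_smul] at h1
  exact h1
end WeylFree


namespace WeylFree
open Polynomial

/-- Two vectors are related by an automorphism of the free module. -/
def Rel {R : Type} [CommRing R] {ι : Type} (v w : ι → R) : Prop :=
  ∃ e : (ι → R) ≃ₗ[R] (ι → R), e v = w

section Rel
variable {R : Type} [CommRing R] {ι : Type}

theorem Rel.refl (v : ι → R) : Rel v v := ⟨LinearEquiv.refl _ _, rfl⟩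
theorem Rel.symm {v w : ι → R} (h : Rel v w) : Rel w v := by
  obtain ⟨e, rfl⟩ := h
  exact ⟨e.symm, by simp⟩
theorem Rel.trans {v w u : ι → R} (h : Rel v w) (h' : Rel w u) : Rel v u := by
  obtain ⟨e, rfl⟩ := h
  obtain ⟨e', rfl⟩ := h'
  exact ⟨e.trans e', rfl⟩

theorem Rel.map [Fintype ι] [DecidableEq ι] {S : Type} [CommRing S] (f : R →+* S) {v w : ι → R} (h : Rel v w) :
    Rel (fun i => f (v i)) (fun i => f (w i)) := by
  obtain ⟨e, rfl⟩ := h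
  let A := LinearMap.toMatrix' (e : (ι → R) →ₗ[R] (ι → R))
  let B := LinearMap.toMatrix' (e.symm : (ι → R) →ₗ[R] (ι → R))
  have hAB : A * B = 1 := by
    simp only [A, B]
    rw [← LinearMap.toMatrix'_comp]
    simp
  have hBA : B * A = 1 := by
    simp only [A, B]
    rw [← LinearMap.toMatrix'_comp]
    simp
  have hAB' : A.map f * B.map f = 1 := by
    rw [← Matrix.map_mul, hAB]; simp
  have hBA' : B.map f * A.map f = 1 := by
    rw [← Matrix.map_mul, hBA]; simp
  refine ⟨Matrix.toLin'OfInv hBA' hAB', ?_⟩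
  have h1 : ⇑e v = A.mulVec v := by
    simp [A]
  simp only [h1]
  ext i
  simp [Matrix.mulVec, dotProduct]

variable [DecidableEq ι]

theorem Rel.scale (v : ι → R) (i : ι) (u : Rˣ) :
    Rel v (Function.update v i (u * v i)) := by
  refine ⟨LinearEquiv.piCongrRight fun j =>
    if j = i then LinearEquiv.smulOfUnit u else LinearEquiv.refl _ _, ?_⟩
  ext j
  by_cases h : j = i
  · subst h; simp; rfl
  · simp [h]

/-- A block of determinant one acting on two coordinates. -/
theorem Rel.block (v : ι → R) (i j : ι) (hij : i ≠ j) (p q r s : R) (hdet : p * s - q * r = 1) :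
    Rel v (Function.update (Function.update v i (p * v i + q * v j)) j (r * v i + s * v j)) := by
  let F : R → R → R → R → ((ι → R) →ₗ[R] (ι → R)) := fun p q r s =>
    { toFun := fun v => Function.update (Function.update v i (p * v i + q * v j)) j (r * v i + s * v j)
      map_add' := fun v w => by
        ext k
        simp only [Function.update_apply, Pi.add_apply]
        split_ifs <;> ring
      map_smul' := fun a w => by
        ext k
        simp only [Function.update_apply, Pi.smul_apply, smul_eq_mul, RingHom.id_apply]
        split_ifs <;> ring }
  have hF : ∀ p q r s v, F p q r s v = Function.update (Function.update v i (p * v i + q * v j)) j (r * v i + s * v j) :=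
    fun _ _ _ _ _ => rfl
  have hcomp : ∀ p q r s : R, p * s - q * r = 1 → F s (-q) (-r) p ∘ₗ F p q r s = LinearMap.id := by
    intro p q r s h
    apply LinearMap.ext
    intro v
    ext k
    simp only [LinearMap.comp_apply, hF, Function.update_apply, LinearMap.id_apply, hij, if_true, if_false]
    split_ifs with h1 h2
    · subst h1; linear_combination (v k) * h
    · subst h2; linear_combination (v k) * h
    · rfl
  refine ⟨LinearEquiv.ofLinearMap (F p q r s) (F s (-q) (-r) p) ?_ (hcomp _ _ _ _ hdet), rfl⟩
  have := hcomp s (-q) (-r) p (by linear_combination hdet)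
  simpa using this

theorem Rel.add_mul (v : ι → R) (i j : ι) (hij : i ≠ j) (c : R) :
    Rel v (Function.update v i (v i + c * v j)) := by
  have := Rel.block v i j hij 1 c 0 1 (by ring)
  convert this using 1
  ext k
  simp only [Function.update_apply]
  split_ifs <;> simp_all

theorem Rel.add_sum (v : ι → R) (i : ι) (s : Finset ι) (hs : i ∉ s) (c : ι → R) :
    Rel v (Function.update v i (v i + ∑ j ∈ s, c j * v j)) := by
  induction s using Finset.induction_on with
  | empty => simp [Rel.refl]
  | insert a s ha ih =>
    rw [Finset.mem_insert, not_or] at hs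
    refine (ih hs.2).trans ?_
    have := Rel.add_mul (Function.update v i (v i + ∑ j ∈ s, c j * v j)) i a hs.1 (c a)
    convert this using 1
    rw [Function.update_idem, Finset.sum_insert ha]
    simp [Function.update_of_ne (Ne.symm hs.1)]
    congr 1; ring

/-- Change coordinates other than `i, j` modulo the ideal generated by coordinates `i, j`. -/
theorem Rel.change [Fintype ι] (v w : ι → R) (i j : ι) (hi : w i = v i) (hj : w j = v j)
    (h : ∀ k, w k - v k ∈ Ideal.span {v i, v j}) : Rel v w := by
  have key : ∀ s : Finset ι, i ∉ s → j ∉ s → Rel v (fun k => if k ∈ s then w k else v k) := by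
    intro s
    induction s using Finset.induction_on with
    | empty => intro _ _; simpa using Rel.refl v
    | insert a s ha ih =>
      intro h1 h2
      rw [Finset.mem_insert, not_or] at h1 h2
      refine (ih h1.2 h2.2).trans ?_
      obtain ⟨x, y, hxy⟩ := Ideal.mem_span_pair.mp (h a)
      refine (Rel.add_mul _ a i (Ne.symm h1.1) x).trans ?_
      refine (Rel.add_mul _ a j (Ne.symm h2.1) y).trans ?_
      convert Rel.refl _ using 1
      ext k
      simp only [Function.update_apply, h1.2, h2.2, ha, if_false, Finset.mem_insert, if_true]
      by_cases hk : k = a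
      · subst hk
        simp [Ne.symm (Ne.symm h2.1)]
        linear_combination -hxy
      · simp [hk]
  have := key (Finset.univ \ {i, j}) (by simp) (by simp)
  convert this using 1
  ext k
  by_cases h1 : k = i
  · subst h1; simp [hi]
  by_cases h2 : k = j
  · subst h2; simp [hj]
  simp [h1, h2]

end Rel

/-- Suslin lemma. -/
theorem suslin_lemma {A : Type} [CommRing A] [IsDomain A] {ι : Type} [Fintype ι] [DecidableEq ι]
    (v : ι → A[X]) (i j : ι) (hij : i ≠ j) (c : A) (hc0 : c ≠ 0)
    (hc : C c ∈ Ideal.span {v i, v j}) (b y : A[X]) :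
    Rel (fun k => (v k).comp b) (fun k => (v k).comp (b + C c * y)) := by
  obtain ⟨g, h, hgh⟩ := Ideal.mem_span_pair.mp hc
  have hdiv : ∀ p : A[X], ∃ q, p.comp (b + C c * y) = p.comp b + C c * q := by
    intro p
    obtain ⟨q, hq⟩ := Polynomial.sub_dvd_eval_sub (b + C c * y) b (p.map C)
    rw [← eval₂_eq_eval_map, ← eval₂_eq_eval_map] at hq
    change p.comp _ - p.comp _ = _ at hq
    exact ⟨y * q, by linear_combination hq⟩
  choose Q hQ using hdiv
  have e1 : g.comp b * (v i).comp b + h.comp b * (v j).comp b = C c := by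
    have := congrArg (fun p : A[X] => p.comp b) hgh
    simpa using this
  have e2 : g.comp (b + C c * y) * (v i).comp (b + C c * y) + h.comp (b + C c * y) * (v j).comp (b + C c * y) = C c := by
    have := congrArg (fun p : A[X] => p.comp (b + C c * y)) hgh
    simpa using this
  have hC0 : (C c : A[X]) ≠ 0 := by simpa using hc0
  rw [hQ, hQ, hQ, hQ] at e2
  -- first adjust the other coordinates
  let w : ι → A[X] := fun k => if k = i ∨ k = j then (v k).comp b else (v k).comp (b + C c * y)
  have r1 : Rel (fun k => (v k).comp b) w := by
    apply Rel.change _ _ i j (by simp [w]) (by simp [w])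
    intro k
    have hcb : C c ∈ Ideal.span {(v i).comp b, (v j).comp b} :=
      Ideal.mem_span_pair.mpr ⟨_, _, e1⟩
    simp only [w]
    split_ifs
    · simp
    · rw [hQ]
      have := Ideal.mul_mem_right (Q (v k)) _ hcb
      convert this using 1; ring
  refine r1.trans ?_
  -- matrix taking the value at the first point to the value at the second
  set F := (v i).comp b
  set G := (v j).comp b
  set g0 := g.comp b
  set h0 := h.comp b
  set F' := Q (v i)
  set G' := Q (v j)
  set g' := Q g
  set h' := Q h
  have e3 : g' * F + g0 * F' + h' * G + h0 * G' + C c * (g' * F' + h' * G') = 0 := by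
    apply mul_left_cancel₀ hC0
    linear_combination e2 - e1
  have hd : (1 + F' * g0 + h' * G) * (1 + G' * h0 + g' * F) - (F' * h0 - h' * F) * (G' * g0 - g' * G) = 1 := by
    linear_combination e3 + (g' * F' + h' * G') * e1
  have r2 := Rel.block w i j hij (1 + F' * g0 + h' * G) (F' * h0 - h' * F) (G' * g0 - g' * G) (1 + G' * h0 + g' * F) hd
  convert r2 using 1
  ext1 k
  have hwi : w i = F := by simp [w, F]
  have hwj : w j = G := by simp [w, G]
  simp only [Function.update_apply, hwi, hwj]
  split_ifs with h1 h2
  · subst h1; rw [hQ]; linear_combination -(G') * e1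
  · subst h2; rw [hQ]; linear_combination -(F') * e1
  · simp [w, h1, h2]

theorem exists_coprime_add {k : Type} [Field k] (a b d : k[X]) (ha : a ≠ 0)
    (h : ∀ p, Prime p → p ∣ a → p ∣ b → p ∣ d → False) : ∃ c, IsCoprime a (b + c * d) := by
  classical
  let s := (UniqueFactorizationMonoid.normalizedFactors a).toFinset.filter (fun q => ¬ q ∣ b)
  refine ⟨∏ q ∈ s, q, ?_⟩
  apply isCoprime_of_prime_dvd
  · rintro ⟨h1, _⟩; exact ha h1
  intro p hp hpa hpb
  by_cases hb : p ∣ b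
  · have hd : ¬ p ∣ d := fun hd => h p hp hpa hb hd
    have h1 : p ∣ (∏ q ∈ s, q) * d := (dvd_add_right hb).mp hpb
    rcases hp.dvd_or_dvd h1 with h2 | h2
    · obtain ⟨q, hq, hpq⟩ := (Prime.dvd_finsetProd_iff hp _).mp h2
      simp only [s, Finset.mem_filter, Multiset.mem_toFinset] at hq
      have hqi := UniqueFactorizationMonoid.irreducible_of_normalized_factor q hq.1
      have := (hp.irreducible.associated_of_dvd hqi hpq)
      exact hq.2 (this.symm.dvd.trans hb)
    · exact hd h2
  · obtain ⟨q, hq, hpq⟩ := UniqueFactorizationMonoid.exists_mem_normalizedFactors_of_dvd ha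
      hp.irreducible hpa
    have hqs : q ∈ s := by
      simp only [s, Finset.mem_filter, Multiset.mem_toFinset]
      exact ⟨hq, fun h => hb (hpq.dvd.trans h)⟩
    have h1 : p ∣ (∏ q ∈ s, q) * d :=
      (hpq.dvd.trans (Finset.dvd_prod_of_mem (fun q => q) hqs)).mul_right d
    exact hb ((dvd_add_left h1).mp hpb)

theorem exists_not_mem_maximal {A : Type} [CommRing A] (I : Ideal A) [hI : I.IsMaximal]
    (f g : A[X]) (hf : f.Monic)
    (h : IsCoprime (f.map (Ideal.Quotient.mk I)) (g.map (Ideal.Quotient.mk I))) :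
    ∃ r, r ∉ I ∧ C r ∈ Ideal.span {f, g} := by
  let J : Ideal A[X] := Ideal.span {f, g}
  have hfin : Module.Finite A (A[X] ⧸ J) := by
    have : Module.Finite A (A[X] ⧸ Ideal.span {f}) := hf.finite_quotient
    have hle : Ideal.span {f} ≤ J := Ideal.span_mono (by simp)
    exact Module.Finite.of_surjective (Ideal.Quotient.factorₐ A hle).toLinearMap
      (Ideal.Quotient.factor_surjective hle)
  obtain ⟨α, β, hαβ⟩ := h
  obtain ⟨α, rfl⟩ := Polynomial.map_surjective _ Ideal.Quotient.mk_surjective α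
  obtain ⟨β, rfl⟩ := Polynomial.map_surjective _ Ideal.Quotient.mk_surjective β
  have he : α * f + β * g - 1 ∈ I.map (C : A →+* A[X]) := by
    rw [← Ideal.mk_ker (I := I), ← Polynomial.ker_mapRingHom, RingHom.mem_ker]
    simp [hαβ]
  have hle : (⊤ : Submodule A (A[X] ⧸ J)) ≤ I • ⊤ := by
    intro x _
    rw [Ideal.smul_top_eq_map, Submodule.restrictScalars_mem]
    obtain ⟨x, rfl⟩ := Ideal.Quotient.mk_surjective x
    have h1 := Ideal.mem_map_of_mem (Ideal.Quotient.mk J) he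
    rw [Ideal.map_map] at h1
    have h2 : Ideal.Quotient.mk J (-x * (α * f + β * g - 1)) = Ideal.Quotient.mk J x := by
      rw [Ideal.Quotient.eq]
      exact Ideal.mem_span_pair.mpr ⟨-x * α, -x * β, by ring⟩
    have h3 := Ideal.mul_mem_left _ (Ideal.Quotient.mk J (-x)) h1
    rw [← map_mul, h2] at h3
    exact h3
  obtain ⟨r, hr, hr'⟩ := Submodule.exists_sub_one_mem_and_smul_eq_zero_of_fg_of_le_smul I
    (⊤ : Submodule A (A[X] ⧸ J)) (Module.finite_def.mp hfin) hle
  refine ⟨r, fun hrI => ?_, ?_⟩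
  · apply hI.ne_top
    rw [Ideal.eq_top_iff_one]
    have := I.sub_mem hrI hr
    simpa using this
  · have := hr' (Ideal.Quotient.mk J 1) trivial
    rw [← Ideal.Quotient.eq_zero_iff_mem (I := J)]
    have h4 : r • (Ideal.Quotient.mk J 1) = Ideal.Quotient.mk J (r • (1 : A[X])) := rfl
    rw [h4, Polynomial.smul_eq_C_mul, mul_one] at this
    exact this

theorem exists_key {A : Type} [CommRing A] (I : Ideal A) [hI : I.IsMaximal]
    {ι : Type} [Fintype ι] [DecidableEq ι] (v u : ι → A[X]) (hu : ∑ k, u k * v k = 1) (i j : ι)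
    (hij : i ≠ j) (hm : (v i).Monic) :
    ∃ (c : ι → A[X]) (r : A), r ∉ I ∧
      C r ∈ Ideal.span {v i, v j + ∑ k ∈ Finset.univ \ {i, j}, c k * v k} := by
  let _ := Ideal.Quotient.field I
  let φ := Polynomial.mapRingHom (Ideal.Quotient.mk I)
  let s : Finset ι := Finset.univ \ {i, j}
  let K : Ideal (A ⧸ I)[X] := Ideal.span (Set.image (fun k => φ (v k)) s)
  let d := Submodule.IsPrincipal.generator K
  have hd : d ∈ K := Submodule.IsPrincipal.generator_mem K
  obtain ⟨c', hc'⟩ : ∃ c' : ι → (A ⧸ I)[X], ∑ k ∈ s, c' k * φ (v k) = d := by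
    obtain ⟨c', hc'⟩ := (Submodule.mem_span_image_finset_iff_exists_fun (A ⧸ I)[X]).mp hd
    refine ⟨fun k => if h : k ∈ s then c' ⟨k, h⟩ else 0, ?_⟩
    rw [← hc', ← Finset.sum_coe_sort]
    apply Finset.sum_congr rfl
    intro k _
    simp
  have hcop : ∃ c, IsCoprime (φ (v i)) (φ (v j) + c * d) := by
    apply exists_coprime_add
    · exact (hm.map _).ne_zero
    · intro p hp h1 h2 h3
      apply hp.not_isUnit
      apply isUnit_of_dvd_one
      rw [← map_one φ, ← hu, map_sum]
      apply Finset.dvd_sum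
      intro k _
      rw [map_mul]
      apply Dvd.dvd.mul_left
      by_cases hk1 : k = i
      · subst hk1; exact h1
      by_cases hk2 : k = j
      · subst hk2; exact h2
      · refine h3.trans ?_
        rw [← Submodule.IsPrincipal.mem_iff_generator_dvd]
        exact Ideal.subset_span ⟨k, by simp [s, hk1, hk2], rfl⟩
  obtain ⟨c, hc⟩ := hcop
  have hsurj : Function.Surjective φ := Polynomial.map_surjective _ Ideal.Quotient.mk_surjective
  choose l hl using fun k => hsurj (c * c' k)
  refine ⟨l, exists_not_mem_maximal I _ _ hm ?_⟩
  change IsCoprime (φ _) (φ _)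
  convert hc using 1
  rw [map_add, map_sum, ← hc', Finset.mul_sum]
  simp [hl, s, mul_assoc]

theorem rel_eval_zero {A : Type} [CommRing A] [IsDomain A]
    {ι : Type} [Fintype ι] [DecidableEq ι] (v u : ι → A[X]) (hu : ∑ k, u k * v k = 1) (i j : ι)
    (hij : i ≠ j) (hm : (v i).Monic) :
    Rel v (fun k => C ((v k).eval 0)) := by
  let I : Ideal A :=
    { carrier := {c | ∀ b y : A[X], Rel (fun k => (v k).comp b) (fun k => (v k).comp (b + C c * y))}
      zero_mem' := fun b y => by simpa using Rel.refl _
      add_mem' := fun {c d} hc hd b y => by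
        refine (hc b y).trans ?_
        have := hd (b + C c * y) y
        convert this using 3
        rw [map_add]; ring
      smul_mem' := fun a c hc b y => by
        have := hc b (C a * y)
        convert this using 3
        rw [smul_eq_mul, map_mul]; ring }
  have hI : I = ⊤ := by
    by_contra hne
    obtain ⟨m, hm', hle⟩ := Ideal.exists_le_maximal I hne
    obtain ⟨c, r, hr, hc⟩ := exists_key m v u hu i j hij hm
    apply hr
    apply hle
    intro b y
    let w := Function.update v j (v j + ∑ k ∈ Finset.univ \ {i, j}, c k * v k)
    have hw : ∀ b : A[X], Rel (fun k => (v k).comp b) (fun k => (w k).comp b) := by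
      intro b
      have := Rel.add_sum (fun k => (v k).comp b) j (Finset.univ \ {i, j}) (by simp)
        (fun k => (c k).comp b)
      convert this using 1
      ext1 k
      simp only [w, Function.update_apply]
      split_ifs
      · simp [Polynomial.add_comp, Polynomial.sum_comp, Polynomial.mul_comp]
      · rfl
    refine (hw b).trans (Rel.trans ?_ (hw _).symm)
    apply suslin_lemma w i j hij r
    · rintro rfl; exact hr (zero_mem _)
    · simpa [w, hij] using hc
  have h1 : (1 : A) ∈ I := by rw [hI]; trivial
  have := (h1 0 X).symm
  simpa using this

/-- Unimodular vectors can be completed. -/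
def Uni (R : Type) [CommRing R] : Prop :=
  ∀ (n : ℕ) (v u : Fin n → R), ∑ k, u k * v k = 1 → ∃ i, Rel v (Pi.single i 1)

theorem Uni.of_equiv {R S : Type} [CommRing R] [CommRing S] (e : R ≃+* S) (h : Uni R) : Uni S := by
  intro n v u hu
  obtain ⟨i, hi⟩ := h n (fun k => e.symm (v k)) (fun k => e.symm (u k))
    (by simp only [← map_mul, ← map_sum, hu, map_one])
  refine ⟨i, ?_⟩
  have := hi.map (e : R →+* S)
  convert this using 1
  · simp
  · ext k
    simp only [Pi.single_apply]
    split_ifs <;> simp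

theorem rel_single_of_isUnit {R : Type} [CommRing R] {ι : Type} [Fintype ι] [DecidableEq ι]
    (v : ι → R) (i : ι) (h : IsUnit (v i)) : Rel v (Pi.single i 1) := by
  obtain ⟨x, hx⟩ := h
  refine (Rel.scale v i x⁻¹).trans ?_
  rw [← hx, Units.inv_mul]
  have := Rel.change (Function.update v i 1) (Pi.single i 1) i i (by simp) (by simp) (by
    intro k
    simp)
  exact this

theorem Uni.of_field (k : Type) [Field k] : Uni k := by
  intro n v u hu
  have : ∃ i, v i ≠ 0 := by
    by_contra! h
    simp [h] at hu
  obtain ⟨i, hi⟩ := this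
  exact ⟨i, rel_single_of_isUnit v i hi.isUnit⟩

theorem uni_step {A : Type} [CommRing A] [IsDomain A] (hA : Uni A) (n : ℕ) (v u : Fin n → A[X])
    (hu : ∑ k, u k * v k = 1) (i : Fin n) (hi : IsUnit (v i).leadingCoeff) :
    ∃ i, Rel v (Pi.single i 1) := by
  by_cases hn : ∃ j, i ≠ j
  · obtain ⟨j, hij⟩ := hn
    obtain ⟨x, hx⟩ := hi
    let y : (A[X])ˣ := Units.map (C : A →+* A[X]).toMonoidHom x
    let w := Function.update v i ((↑y⁻¹ : A[X]) * v i)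
    have hy : (↑y⁻¹ : A[X]) = C (↑x⁻¹ : A) := rfl
    have hw : Rel v w := Rel.scale v i y⁻¹
    have hmon : (w i).Monic := by
      simp only [w, Function.update_self, hy, Monic, leadingCoeff_mul, leadingCoeff_C, ← hx]
      simp
    have hu' : ∑ k, (Function.update u i (y * u i)) k * w k = 1 := by
      rw [← hu]
      apply Finset.sum_congr rfl
      intro k _
      by_cases hk : k = i
      · subst hk
        simp only [w, Function.update_self]
        have := y.mul_inv
        linear_combination (u k * v k) * this
      · simp [w, hk]
    have h1 := rel_eval_zero w _ hu' i j hij hmon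
    obtain ⟨l, hl⟩ := hA n (fun k => (w k).eval 0) (fun k => (Function.update u i (y * u i) k).eval 0) (by
      have := congrArg (Polynomial.eval 0) hu'
      simpa only [eval_finsetSum, eval_mul, eval_one] using this)
    refine ⟨l, hw.trans (h1.trans ?_)⟩
    have := hl.map (C : A →+* A[X])
    convert this using 1
    ext1 k
    simp only [Pi.single_apply]
    split_ifs <;> simp
  · push Not at hn
    refine ⟨i, rel_single_of_isUnit v i ?_⟩
    have : (Finset.univ : Finset (Fin n)) = {i} := by
      ext k; simp [hn k]
    rw [this, Finset.sum_singleton] at hu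
    exact IsUnit.of_mul_eq_one_right _ hu

end WeylFree


namespace WeylNoether
section
open Polynomial MvPolynomial Ideal Nat RingHom List

variable {k : Type*} [Field k] {n : ℕ} (f : MvPolynomial (Fin (n + 1)) k)
variable (v w : Fin (n + 1) →₀ ℕ)

variable {f v} in
lemma lt_up (vlt : ∀ i, v i < (2 + f.totalDegree)) : ∀ l ∈ ofFn v, l < (2 + f.totalDegree) := by
  grind



lemma t1_comp_t1_neg (c : k) : (NoetherNormalization.T1 f c).comp (NoetherNormalization.T1 f (-c)) = AlgHom.id _ _ := by
  rw [comp_aeval, ← MvPolynomial.aeval_X_left]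
  ext i v
  cases i using Fin.cases <;> simp

/-- `NoetherNormalization.T1 f 1` leads to an algebra equiv `T f`. -/
noncomputable abbrev T := AlgEquiv.ofAlgHom (NoetherNormalization.T1 f 1) (NoetherNormalization.T1 f (-1))
  (t1_comp_t1_neg f 1) (by simpa using t1_comp_t1_neg f (-1))

lemma sum_r_mul_ne (vlt : ∀ i, v i < (2 + f.totalDegree)) (wlt : ∀ i, w i < (2 + f.totalDegree)) (ne : v ≠ w) :
    ∑ x : Fin (n + 1), (2 + f.totalDegree) ^ x.1 * v x ≠ ∑ x : Fin (n + 1), (2 + f.totalDegree) ^ x.1 * w x := by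
  intro h
  refine ne <| Finsupp.ext <| congrFun <| ofFn_inj.mp ?_
  apply ofDigits_inj_of_len_eq (Nat.lt_add_right f.totalDegree one_lt_two)
    (by simp) (lt_up vlt) (lt_up wlt)
  simpa only [ofDigits_eq_sum_mapIdx, mapIdx_eq_ofFn, get_ofFn, length_ofFn,
    Fin.val_cast, mul_comm, sum_ofFn] using! h

lemma degreeOf_zero_t {a : k} (ha : a ≠ 0) : ((T f) (monomial v a)).degreeOf 0 =
    ∑ i : Fin (n + 1), (2 + f.totalDegree) ^ i.1 * v i := by
  rw [← natDegree_finSuccEquiv, monomial_eq, Finsupp.prod_pow v fun a ↦ X a]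
  simp only [Fin.prod_univ_succ, Fin.sum_univ_succ, map_mul, map_prod, map_pow,
    AlgEquiv.ofAlgHom_apply, MvPolynomial.aeval_C, MvPolynomial.aeval_X, if_pos, Fin.succ_ne_zero,
    ite_false, one_smul, map_add, finSuccEquiv_X_zero, finSuccEquiv_X_succ, algebraMap_eq]
  have h (i : Fin n) :
      (Polynomial.C (X (R := k) i) + Polynomial.X ^ (2 + f.totalDegree) ^ i.succ.1) ^ v i.succ ≠ 0 :=
    pow_ne_zero (v i.succ) (leadingCoeff_ne_zero.mp <| by simp [add_comm, leadingCoeff_X_pow_add_C])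
  rw [natDegree_mul (by simp [ha]) (mul_ne_zero (by simp) (Finset.prod_ne_zero_iff.mpr
    (fun i _ ↦ h i))), natDegree_mul (by simp) (Finset.prod_ne_zero_iff.mpr (fun i _ ↦ h i)),
    natDegree_prod _ _ (fun i _ ↦ h i), natDegree_finSuccEquiv, degreeOf_C]
  simpa only [natDegree_pow, zero_add, natDegree_X, mul_one, Fin.val_zero, pow_zero, one_mul,
    add_right_inj] using Finset.sum_congr rfl (fun i _ ↦ by
    rw [add_comm (Polynomial.C _), natDegree_X_pow_add_C, mul_comm])

/-- `T` maps different monomials of `f` to polynomials with different degrees in `X_0`. -/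
lemma degreeOf_t_ne_of_ne (hv : v ∈ f.support) (hw : w ∈ f.support) (ne : v ≠ w) :
    (T f <| monomial v <| coeff v f).degreeOf 0 ≠
    (T f <| monomial w <| coeff w f).degreeOf 0 := by
  rw [degreeOf_zero_t _ _ <| mem_support_iff.mp hv, degreeOf_zero_t _ _ <| mem_support_iff.mp hw]
  refine sum_r_mul_ne f v w (fun i ↦ ?_) (fun i ↦ ?_) ne <;>
  exact lt_of_le_of_lt ((monomial_le_degreeOf i ‹_›).trans (degreeOf_le_totalDegree f i))
    (by lia)

lemma leadingCoeff_finSuccEquiv_t :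
    (finSuccEquiv k n ((T f) ((monomial v) (coeff v f)))).leadingCoeff =
    algebraMap k _ (coeff v f) := by
  rw [monomial_eq, Finsupp.prod_fintype]
  · simp only [map_mul, map_prod, leadingCoeff_mul, leadingCoeff_prod]
    rw [AlgEquiv.ofAlgHom_apply, algHom_C, algebraMap_eq, finSuccEquiv_apply,
      eval₂Hom_C, coe_comp]
    simp only [AlgEquiv.ofAlgHom_apply, Function.comp_apply, leadingCoeff_C, map_pow,
      leadingCoeff_pow, algebraMap_eq]
    have : ∀ j, ((finSuccEquiv k n) ((NoetherNormalization.T1 f) 1 (X j))).leadingCoeff = 1 := fun j ↦ by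
      by_cases h : j = 0
      · simp [h, finSuccEquiv_apply]
      · simp only [aeval_eq_bind₁, bind₁_X_right, if_neg h, one_smul, map_add, map_pow]
        obtain ⟨i, rfl⟩ := Fin.exists_succ_eq.mpr h
        simp [finSuccEquiv_X_succ, finSuccEquiv_X_zero, add_comm]
    simp only [this, one_pow, Finset.prod_const_one, mul_one]
  exact fun i ↦ pow_zero _

/-- `T` maps `f` into some polynomial in `X_0` such that the leading coefficient is invertible. -/
lemma t_leadingcoeff_isUnit (fne : f ≠ 0) :
    IsUnit (finSuccEquiv k n (T f f)).leadingCoeff := by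
  obtain ⟨v, vin, vs⟩ := Finset.exists_max_image f.support
    (fun v ↦ (T f ((monomial v) (coeff v f))).degreeOf 0) (support_nonempty.mpr fne)
  set h := fun w ↦ (MvPolynomial.monomial w) (coeff w f)
  simp only [← natDegree_finSuccEquiv] at vs
  replace vs : ∀ x ∈ f.support \ {v}, (finSuccEquiv k n ((T f) (h x))).degree <
      (finSuccEquiv k n ((T f) (h v))).degree := by
    intro x hx
    obtain ⟨h1, h2⟩ := Finset.mem_sdiff.mp hx
    apply degree_lt_degree <| lt_of_le_of_ne (vs x h1) ?_
    simpa only [natDegree_finSuccEquiv]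
      using degreeOf_t_ne_of_ne f _ _ h1 vin <| ne_of_not_mem_cons h2
  have coeff : (finSuccEquiv k n ((T f) (h v + ∑ x ∈ f.support \ {v}, h x))).leadingCoeff =
      (finSuccEquiv k n ((T f) (h v))).leadingCoeff := by
    simp only [map_add, map_sum]
    rw [add_comm]
    apply leadingCoeff_add_of_degree_lt <| (lt_of_le_of_lt <| degree_sum_le _ _) ?_
    have h2 : h v ≠ 0 := by simpa [h] using mem_support_iff.mp vin
    replace h2 : (finSuccEquiv k n ((T f) (h v))) ≠ 0 := fun eq ↦ h2 <|
      by simpa only [map_eq_zero_iff _ (AlgEquiv.injective _)] using eq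
    exact (Finset.sup_lt_iff <| Ne.bot_lt (fun x ↦ h2 <| degree_eq_bot.mp x)).mpr vs
  nth_rw 2 [← f.support_sum_monomial_coeff]
  rw [Finset.sum_eq_add_sum_sdiff_singleton_of_mem vin h]
  rw [leadingCoeff_finSuccEquiv_t] at coeff
  simpa only [coeff, algebraMap_eq] using (mem_support_iff.mp vin).isUnit.map MvPolynomial.C


end
end WeylNoether


namespace WeylFree

theorem uni_mvPolynomial (m : ℕ) : Uni (MvPolynomial (Fin m) ℚ) := by
  induction m with
  | zero => exact Uni.of_equiv (MvPolynomial.isEmptyRingEquiv ℚ (Fin 0)).symm (Uni.of_field ℚ)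
  | succ m ih =>
    intro n v u hu
    have : ∃ i, v i ≠ 0 := by
      by_contra! h
      simp [h] at hu
    obtain ⟨i, hi⟩ := this
    let e := ((WeylNoether.T (v i)).trans (MvPolynomial.finSuccEquiv ℚ m)).toRingEquiv
    have h1 := WeylNoether.t_leadingcoeff_isUnit (v i) hi
    obtain ⟨l, hl⟩ := uni_step ih n (fun k => e (v k)) (fun k => e (u k))
      (by simp only [← map_mul, ← map_sum, hu, map_one]) i h1
    refine ⟨l, ?_⟩
    have := hl.map e.symm.toRingHom
    convert this using 1
    · ext1 k; exact (e.symm_apply_apply (v k)).symm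
    · ext1 k
      simp only [Pi.single_apply]
      split_ifs
      · exact (map_one e.symm.toRingHom).symm
      · exact (map_zero e.symm.toRingHom).symm

end WeylFree


namespace WeylFree
section FiniteFreeResolutions

/-- Finite (stably) free resolutions of length `n`. -/
def FFR (R : Type) [CommRing R] : ℕ → ∀ (M : Type) [AddCommGroup M] [Module R M], Prop
  | 0, M, _, _ => ∃ a b : ℕ, Nonempty ((M × (Fin a → R)) ≃ₗ[R] (Fin b → R))
  | n + 1, M, _, _ => ∃ (a : ℕ) (f : (Fin a → R) →ₗ[R] M), Function.Surjective f ∧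
      FFR R n (LinearMap.ker f)

variable {R : Type} [CommRing R]

theorem finfree_equiv (F : Type) [AddCommGroup F] [Module R F] [Module.Free R F]
    [Module.Finite R F] : ∃ a : ℕ, Nonempty (F ≃ₗ[R] (Fin a → R)) := by
  classical
  rcases subsingleton_or_nontrivial R with h | h
  · have := Module.subsingleton R F
    have := Module.subsingleton R (Fin 0 → R)
    exact ⟨0, ⟨LinearEquiv.ofSubsingleton _ _⟩⟩
  · exact ⟨_, ⟨(Module.finBasis R F).equivFun⟩⟩

theorem FFR.of_equiv {n : ℕ} {M N : Type} [AddCommGroup M] [Module R M] [AddCommGroup N]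
    [Module R N] (e : M ≃ₗ[R] N) (h : FFR R n M) : FFR R n N := by
  cases n with
  | zero =>
    obtain ⟨a, b, ⟨g⟩⟩ := h
    exact ⟨a, b, ⟨(e.symm.prodCongr (LinearEquiv.refl R _)).trans g⟩⟩
  | succ n =>
    obtain ⟨a, f, hf, hk⟩ := h
    refine ⟨a, e.toLinearMap ∘ₗ f, e.surjective.comp hf, ?_⟩
    rw [LinearEquiv.ker_comp]
    exact hk

theorem FFR.mk_zero {M F G : Type} [AddCommGroup M] [Module R M] [AddCommGroup F]
    [Module R F] [AddCommGroup G] [Module R G] [Module.Free R F] [Module.Finite R F]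
    [Module.Free R G] [Module.Finite R G] (e : (M × F) ≃ₗ[R] G) : FFR R 0 M := by
  obtain ⟨a, ⟨f⟩⟩ := finfree_equiv (R := R) F
  obtain ⟨b, ⟨g⟩⟩ := finfree_equiv (R := R) G
  exact ⟨a, b, ⟨((LinearEquiv.refl R M).prodCongr f.symm).trans (e.trans g)⟩⟩

/-- The kernel of a surjection in an exact sequence. -/
theorem exists_equiv_ker {K F M : Type} [AddCommGroup K] [Module R K] [AddCommGroup F]
    [Module R F] [AddCommGroup M] [Module R M] (i : K →ₗ[R] F) (f : F →ₗ[R] M)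
    (hi : Function.Injective i) (h : Function.Exact i f) :
    Nonempty (K ≃ₗ[R] LinearMap.ker f) := by
  rw [h.linearMap_ker_eq]
  exact ⟨LinearEquiv.ofInjective i hi⟩

theorem FFR.mk_succ {n : ℕ} {K F M : Type} [AddCommGroup K] [Module R K] [AddCommGroup F]
    [Module R F] [AddCommGroup M] [Module R M] [Module.Free R F] [Module.Finite R F]
    (i : K →ₗ[R] F) (f : F →ₗ[R] M) (hi : Function.Injective i) (hf : Function.Surjective f)
    (h : Function.Exact i f) (hK : FFR R n K) : FFR R (n + 1) M := by
  obtain ⟨a, ⟨e⟩⟩ := finfree_equiv (R := R) F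
  obtain ⟨k⟩ := exists_equiv_ker (e.toLinearMap ∘ₗ i) (f ∘ₗ e.symm.toLinearMap)
    (e.injective.comp hi) (by
      intro y
      have := h (e.symm y)
      simp only [LinearMap.comp_apply, LinearEquiv.coe_coe, this, Set.mem_range]
      constructor
      · rintro ⟨x, hx⟩; exact ⟨x, by rw [hx]; simp⟩
      · rintro ⟨x, hx⟩; exact ⟨x, by rw [← hx]; simp⟩)
  exact ⟨a, f ∘ₗ e.symm.toLinearMap, hf.comp e.symm.surjective, hK.of_equiv k⟩

theorem FFR.mono_succ {n : ℕ} : ∀ {M : Type} [AddCommGroup M] [Module R M],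
    FFR R n M → FFR R (n + 1) M := by
  induction n with
  | zero =>
    intro M _ _ h
    obtain ⟨a, b, ⟨e⟩⟩ := h
    refine FFR.mk_succ (K := Fin a → R) (F := Fin b → R)
      (e.toLinearMap ∘ₗ LinearMap.inr R M (Fin a → R))
      (LinearMap.fst R M (Fin a → R) ∘ₗ e.symm.toLinearMap)
      (e.injective.comp LinearMap.inr_injective)
      ((LinearMap.fst_surjective (R := R)).comp e.symm.surjective) ?_ ?_
    · intro y
      simp only [LinearMap.comp_apply, LinearEquiv.coe_coe, Set.mem_range, LinearMap.fst_apply,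
        LinearMap.inr_apply]
      constructor
      · intro h
        refine ⟨(e.symm y).2, ?_⟩
        rw [← h]; simp
      · rintro ⟨x, rfl⟩; simp
    · exact FFR.mk_zero (F := Fin 0 → R) (G := (Fin a → R) × (Fin 0 → R)) (LinearEquiv.refl R _)
  | succ n ih =>
    intro M _ _ h
    obtain ⟨a, f, hf, hk⟩ := h
    exact ⟨a, f, hf, ih hk⟩

theorem FFR.mono {n k : ℕ} (hnk : n ≤ k) {M : Type} [AddCommGroup M] [Module R M]
    (h : FFR R n M) : FFR R k M := by
  induction hnk with
  | refl => exact h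
  | step _ ih => exact ih.mono_succ

theorem FFR.projective {M : Type} [AddCommGroup M] [Module R M] (h : FFR R 0 M) :
    Module.Projective R M := by
  obtain ⟨a, b, ⟨e⟩⟩ := h
  have : Module.Projective R (M × (Fin a → R)) := Module.Projective.of_equiv e.symm
  exact Module.Projective.of_split (LinearMap.inl R M (Fin a → R)) (LinearMap.fst R M _)
    (by ext; simp)

theorem exists_prod_equiv {A B C : Type} [AddCommGroup A] [Module R A] [AddCommGroup B]
    [Module R B] [AddCommGroup C] [Module R C] [Module.Projective R C]
    (i : A →ₗ[R] B) (g : B →ₗ[R] C)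
    (hi : Function.Injective i) (hg : Function.Surjective g) (h : Function.Exact i g) :
    Nonempty (B ≃ₗ[R] (A × C)) := by
  obtain ⟨s, hs⟩ := Module.projective_lifting_property g LinearMap.id hg
  exact ⟨(h.splitSurjectiveEquiv hi ⟨s, hs⟩).1⟩

theorem FFR.ext {n : ℕ} : ∀ {A B C : Type} [AddCommGroup A] [Module R A] [AddCommGroup B]
    [Module R B] [AddCommGroup C] [Module R C] (i : A →ₗ[R] B) (g : B →ₗ[R] C)
    (_ : Function.Injective i) (_ : Function.Surjective g) (_ : Function.Exact i g),
    FFR R n A → FFR R n C → FFR R n B := by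
  induction n with
  | zero =>
    intro A B C _ _ _ _ _ _ i g hi hg h hA hC
    have := hC.projective
    obtain ⟨e⟩ := exists_prod_equiv i g hi hg h
    obtain ⟨a, a', ⟨eA⟩⟩ := hA
    obtain ⟨c, c', ⟨eC⟩⟩ := hC
    exact FFR.mk_zero ((e.prodCongr (LinearEquiv.refl R ((Fin a → R) × (Fin c → R)))).trans
      ((LinearEquiv.prodProdProdComm R A C (Fin a → R) (Fin c → R)).trans (eA.prodCongr eC)))
  | succ n ih =>
    intro A B C _ _ _ _ _ _ i g hi hg h hA hC
    obtain ⟨a, fA, hfA, hkA⟩ := hA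
    obtain ⟨c, fC, hfC, hkC⟩ := hC
    obtain ⟨s, hs⟩ := Module.projective_lifting_property g fC hg
    have hs' : ∀ y, g (s y) = fC y := fun y => by rw [← hs]; rfl
    have hgi : ∀ x, g (i x) = 0 := fun x => h.apply_apply_eq_zero x
    let Φ : ((Fin a → R) × (Fin c → R)) →ₗ[R] B := (i ∘ₗ fA).coprod s
    have hΦ : ∀ x y, Φ (x, y) = i (fA x) + s y := fun x y => by simp [Φ]
    have hsurj : Function.Surjective Φ := by
      intro b
      obtain ⟨y, hy⟩ := hfC (g b)
      obtain ⟨z, hz⟩ := (h (b - s y)).mp (by rw [map_sub, hs', hy, sub_self])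
      obtain ⟨x, rfl⟩ := hfA z
      exact ⟨(x, y), by rw [hΦ, hz]; abel⟩
    refine FFR.mk_succ (LinearMap.ker Φ).subtype Φ (Submodule.subtype_injective _) hsurj
      (LinearMap.exact_subtype_ker_map Φ) ?_
    let α : LinearMap.ker fA →ₗ[R] LinearMap.ker Φ :=
      (LinearMap.inl R (Fin a → R) (Fin c → R) ∘ₗ (LinearMap.ker fA).subtype).codRestrict _ (by
        rintro ⟨x, hx⟩
        rw [LinearMap.mem_ker] at hx ⊢
        simp [hΦ, hx])
    let β : LinearMap.ker Φ →ₗ[R] LinearMap.ker fC :=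
      (LinearMap.snd R (Fin a → R) (Fin c → R) ∘ₗ (LinearMap.ker Φ).subtype).codRestrict _ (by
        rintro ⟨⟨x, y⟩, hx⟩
        rw [LinearMap.mem_ker, hΦ] at hx
        have := congrArg g hx
        rw [map_add, hgi, zero_add, hs', map_zero] at this
        simpa using this)
    refine ih α β ?_ ?_ ?_ hkA hkC
    · intro x y hxy
      have := congrArg (fun z => z.1.1) hxy
      exact Subtype.ext this
    · rintro ⟨y, hy⟩
      rw [LinearMap.mem_ker] at hy
      obtain ⟨z, hz⟩ := (h (s y)).mp (by rw [hs', hy])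
      obtain ⟨x, rfl⟩ := hfA z
      exact ⟨⟨(-x, y), by rw [LinearMap.mem_ker, hΦ, map_neg, map_neg, hz]; abel⟩, rfl⟩
    · rintro ⟨⟨x, y⟩, hx⟩
      rw [LinearMap.mem_ker, hΦ] at hx
      constructor
      · intro h0
        have hy : y = 0 := congrArg Subtype.val h0
        subst hy
        rw [map_zero, add_zero] at hx
        exact ⟨⟨x, hi (by rw [hx, map_zero])⟩, rfl⟩
      · rintro ⟨z, hz⟩
        have := congrArg (fun z => z.1.2) hz
        exact Subtype.ext this.symm

theorem FFR.coker {n : ℕ} {A B C : Type} [AddCommGroup A] [Module R A] [AddCommGroup B]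
    [Module R B] [AddCommGroup C] [Module R C] (i : A →ₗ[R] B) (g : B →ₗ[R] C)
    (hi : Function.Injective i) (hg : Function.Surjective g) (h : Function.Exact i g)
    (hA : FFR R n A) (hB : FFR R n B) : FFR R (n + 1) C := by
  obtain ⟨b, f, hf, hk⟩ := hB.mono_succ
  refine ⟨b, g ∘ₗ f, hg.comp hf, ?_⟩
  obtain ⟨k⟩ := exists_equiv_ker i g hi h
  let α : LinearMap.ker f →ₗ[R] LinearMap.ker (g ∘ₗ f) :=
    Submodule.inclusion (LinearMap.ker_le_ker_comp f g)
  let β : LinearMap.ker (g ∘ₗ f) →ₗ[R] LinearMap.ker g :=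
    (f ∘ₗ (LinearMap.ker (g ∘ₗ f)).subtype).codRestrict _ (by
      rintro ⟨x, hx⟩
      exact hx)
  refine FFR.ext α β (Submodule.inclusion_injective _) ?_ ?_ hk (hA.of_equiv k)
  · rintro ⟨y, hy⟩
    obtain ⟨x, rfl⟩ := hf y
    exact ⟨⟨x, hy⟩, rfl⟩
  · rintro ⟨x, hx⟩
    constructor
    · intro h0
      exact ⟨⟨x, congrArg Subtype.val h0⟩, rfl⟩
    · rintro ⟨⟨z, hz⟩, h0⟩
      have : z = x := congrArg Subtype.val h0
      subst this
      exact Subtype.ext hz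

theorem FFR.stablyFree {n : ℕ} : ∀ {M : Type} [AddCommGroup M] [Module R M]
    [Module.Projective R M], FFR R n M → FFR R 0 M := by
  induction n with
  | zero => intro M _ _ _ h; exact h
  | succ n ih =>
    intro M _ _ _ h
    obtain ⟨a, f, hf, hk⟩ := h
    obtain ⟨e⟩ := exists_prod_equiv (LinearMap.ker f).subtype f (Submodule.subtype_injective _) hf
      (LinearMap.exact_subtype_ker_map f)
    have : Module.Projective R (LinearMap.ker f × M) := Module.Projective.of_equiv e
    have : Module.Projective R (LinearMap.ker f) :=
      Module.Projective.of_split (LinearMap.inl R _ M) (LinearMap.fst R _ M) (by ext; simp)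
    obtain ⟨b, c, ⟨k⟩⟩ := ih hk
    refine FFR.mk_zero (F := Fin c → R) (G := (Fin a → R) × (Fin b → R)) ?_
    exact ((LinearEquiv.refl R M).prodCongr k.symm).trans
      ((LinearEquiv.prodAssoc R M (LinearMap.ker f) (Fin b → R)).symm.trans
        (((LinearEquiv.prodComm R M (LinearMap.ker f)).trans e.symm).prodCongr
          (LinearEquiv.refl R _)))

open TensorProduct in
theorem FFR.baseChange {n : ℕ} (S : Type) [CommRing S] [Algebra R S] [Module.Flat R S] :
    ∀ {M : Type} [AddCommGroup M] [Module R M], FFR R n M → FFR S n (S ⊗[R] M) := by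
  induction n with
  | zero =>
    intro M _ _ h
    obtain ⟨a, b, ⟨e⟩⟩ := h
    exact FFR.mk_zero ((TensorProduct.prodRight R S S M (Fin a → R)).symm.trans
      (e.baseChange R S _ _))
  | succ n ih =>
    intro M _ _ h
    obtain ⟨a, f, hf, hk⟩ := h
    refine FFR.mk_succ ((LinearMap.ker f).subtype.baseChange S) (f.baseChange S) ?_ ?_ ?_ (ih hk)
    · exact Module.Flat.lTensor_preserves_injective_linearMap _ (Submodule.subtype_injective _)
    · exact LinearMap.lTensor_surjective S hf
    · exact lTensor_exact S (LinearMap.exact_subtype_ker_map f) hf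

end FiniteFreeResolutions
end WeylFree


namespace WeylFree
section Swan
open Polynomial TensorProduct

variable {A : Type} [CommRing A]

/-- The coefficient map on `A[X] ⊗ N`. -/
noncomputable def tcoeff (N : Type) [AddCommGroup N] [Module A N] (k : ℕ) : A[X] ⊗[A] N →ₗ[A] N :=
  (TensorProduct.lid A N).toLinearMap ∘ₗ (Polynomial.lcoeff A k).rTensor N

theorem tcoeff_tmul (N : Type) [AddCommGroup N] [Module A N] (k : ℕ) (p : A[X]) (n : N) :
    tcoeff N k (p ⊗ₜ n) = p.coeff k • n := by
  simp [tcoeff]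

theorem exists_tsum {N : Type} [AddCommGroup N] [Module A N] (z : A[X] ⊗[A] N) :
    ∃ (d : ℕ) (n : ℕ → N), z = ∑ k ∈ Finset.range d, (X ^ k : A[X]) ⊗ₜ n k := by
  suffices h : ∃ d, ∀ e, d ≤ e → z = ∑ k ∈ Finset.range e, (X ^ k : A[X]) ⊗ₜ tcoeff N k z by
    obtain ⟨d, hd⟩ := h
    exact ⟨d, _, hd d le_rfl⟩
  induction z with
  | zero => exact ⟨0, by simp⟩
  | tmul p n =>
    refine ⟨p.natDegree + 1, fun e he => ?_⟩
    conv_lhs => rw [p.as_sum_range' e (by omega), TensorProduct.sum_tmul]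
    apply Finset.sum_congr rfl
    intro k _
    rw [tcoeff_tmul, ← smul_tmul, ← Polynomial.smul_X_eq_monomial]
  | add x y hx hy =>
    obtain ⟨d, hd⟩ := hx
    obtain ⟨d', hd'⟩ := hy
    refine ⟨max d d', fun e he => ?_⟩
    conv_lhs => rw [hd e (by omega), hd' e (by omega), ← Finset.sum_add_distrib]
    simp only [map_add, tmul_add]

variable {M : Type} [AddCommGroup M] [Module A[X] M] [Module A M] [IsScalarTower A A[X] M]

theorem swan_ffr (N : ℕ → Submodule A M) (hmono : Monotone N)
    (hT : ∀ j v, v ∈ N j → (X : A[X]) • v ∈ N (j + 1))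
    (hT' : ∀ j v, (X : A[X]) • v ∈ N (j + 1) → v ∈ N j) (J : ℕ)
    (htop : Submodule.span A[X] (N (J + 1) : Set M) = ⊤) (n : ℕ) (h1 : FFR A n (N J))
    (h2 : FFR A n (N (J + 1))) : FFR A[X] (n + 1) M := by
  let T : N J →ₗ[A] N (J + 1) :=
    { toFun := fun v => ⟨(X : A[X]) • v.1, hT J v.1 v.2⟩
      map_add' := fun v w => Subtype.ext (smul_add _ _ _)
      map_smul' := fun a v => Subtype.ext (smul_comm _ _ _) }
  let ι : N J →ₗ[A] N (J + 1) := Submodule.inclusion (hmono (Nat.le_succ J))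
  let i0 : N J →ₗ[A] A[X] ⊗[A] N (J + 1) :=
    (TensorProduct.mk A A[X] (N (J + 1)) X) ∘ₗ ι - (TensorProduct.mk A A[X] (N (J + 1)) 1) ∘ₗ T
  let i : A[X] ⊗[A] N J →ₗ[A[X]] A[X] ⊗[A] N (J + 1) := i0.liftBaseChange A[X]
  let g : A[X] ⊗[A] N (J + 1) →ₗ[A[X]] M := (N (J + 1)).subtype.liftBaseChange A[X]
  have hi : ∀ p n, i (p ⊗ₜ n) = (p * X) ⊗ₜ ι n - p ⊗ₜ T n := by
    intro p n
    simp [i, i0, smul_sub, smul_tmul']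
  have hg : ∀ p n, g (p ⊗ₜ n) = p • n.1 := by
    intro p n
    simp [g]
  have hpow : ∀ k j v, v ∈ N j → (X ^ k : A[X]) • v ∈ N (j + k) := by
    intro k
    induction k with
    | zero => intro j v hv; simpa using hv
    | succ k ih => intro j v hv; rw [pow_succ', mul_smul]; exact hT _ _ (ih j v hv)
  have hpow' : ∀ k j v, (X ^ k : A[X]) • v ∈ N (j + k) → v ∈ N j := by
    intro k
    induction k with
    | zero => intro j v hv; simpa using hv
    | succ k ih => intro j v hv; rw [pow_succ', mul_smul] at hv; exact ih j v (hT' _ _ hv)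
  refine FFR.coker i g ?_ ?_ ?_ (h1.baseChange A[X]) (h2.baseChange A[X])
  · rw [injective_iff_map_eq_zero]
    intro z hz
    have hrec : ∀ k (z : A[X] ⊗[A] N J), tcoeff _ (k + 1) (i z) =
        ι (tcoeff _ k z) - T (tcoeff _ (k + 1) z) := by
      intro k z
      induction z with
      | zero => simp
      | tmul p n => simp [hi, tcoeff_tmul]
      | add x y hx hy => simp only [map_add, hx, hy]; abel
    have hz0 : ∀ k, tcoeff _ (k + 1) z = 0 → tcoeff _ k z = 0 := by
      intro k hk
      have := hrec k z
      rw [hz, map_zero, hk, map_zero, sub_zero] at this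
      exact Submodule.inclusion_injective (hmono (Nat.le_succ J)) (by rw [map_zero]; exact this.symm)
    obtain ⟨d, n, rfl⟩ := exists_tsum z
    have hc : ∀ k, tcoeff _ k (∑ k ∈ Finset.range d, (X ^ k : A[X]) ⊗ₜ n k) =
        if k < d then n k else 0 := by
      intro k
      simp [tcoeff_tmul, Polynomial.coeff_X_pow]
    have hall : ∀ e k, d ≤ k + e → tcoeff _ k (∑ k ∈ Finset.range d, (X ^ k : A[X]) ⊗ₜ n k) = 0 := by
      intro e
      induction e with
      | zero => intro k hk; rw [hc, if_neg (by omega)]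
      | succ e ih => intro k hk; exact hz0 k (ih (k + 1) (by omega))
    apply Finset.sum_eq_zero
    intro k hk
    have := hall d k (by omega)
    rw [hc, if_pos (Finset.mem_range.mp hk)] at this
    rw [this, tmul_zero]
  · rw [← LinearMap.range_eq_top, eq_top_iff, ← htop, Submodule.span_le]
    intro v hv
    exact ⟨1 ⊗ₜ ⟨v, hv⟩, by rw [hg, one_smul]⟩
  · rw [LinearMap.exact_iff]
    apply le_antisymm
    · intro z hz
      rw [LinearMap.mem_ker] at hz
      obtain ⟨d, n, rfl⟩ := exists_tsum z
      induction d generalizing n with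
      | zero => simp
      | succ d ih =>
        cases d with
        | zero =>
          simp only [zero_add, Finset.range_one, Finset.sum_singleton, pow_zero] at hz ⊢
          rw [hg, one_smul] at hz
          have : n 0 = 0 := Subtype.ext hz
          rw [this, tmul_zero]
          exact zero_mem _
        | succ d =>
          have hmem : (n (d + 1)).1 ∈ N J := by
            apply hpow' (d + 1)
            rw [map_sum, Finset.sum_range_succ, hg, add_comm] at hz
            rw [eq_neg_of_add_eq_zero_left hz]
            apply neg_mem
            apply sum_mem
            intro k hk
            rw [hg]
            apply hmono _ (hpow k _ _ (n k).2)
            rw [Finset.mem_range] at hk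
            omega
          let w : N J := ⟨(n (d + 1)).1, hmem⟩
          have key : (∑ k ∈ Finset.range (d + 1 + 1), (X ^ k : A[X]) ⊗ₜ[A] n k) =
              i ((X ^ d : A[X]) ⊗ₜ[A] w) +
              ∑ k ∈ Finset.range (d + 1),
                (X ^ k : A[X]) ⊗ₜ[A] (Function.update n d (n d + T w)) k := by
            rw [Finset.sum_range_succ, Finset.sum_range_succ, Finset.sum_range_succ, hi,
              Function.update_self, tmul_add, pow_succ]
            have e1 : ι w = n (d + 1) := rfl
            have e2 : ∑ k ∈ Finset.range d,
                (X ^ k : A[X]) ⊗ₜ[A] (Function.update n d (n d + T w)) k =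
                ∑ k ∈ Finset.range d, (X ^ k : A[X]) ⊗ₜ[A] n k := by
              apply Finset.sum_congr rfl
              intro k hk
              rw [Finset.mem_range] at hk
              rw [Function.update_of_ne (by omega)]
            rw [e1, e2]
            abel
          rw [key]
          refine add_mem ⟨_, rfl⟩ (ih _ ?_)
          rw [key, map_add] at hz
          have : g (i ((X ^ d : A[X]) ⊗ₜ[A] w)) = 0 := by
            rw [hi, map_sub, hg, hg, mul_smul]
            exact sub_self _
          rwa [this, zero_add] at hz
    · rintro _ ⟨z, rfl⟩
      rw [LinearMap.mem_ker]
      induction z with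
      | zero => simp
      | tmul p n =>
        rw [hi, map_sub, hg, hg, mul_smul]
        exact sub_self _
      | add x y hx hy => rw [map_add, map_add, hx, hy, add_zero]

/-- Every finitely generated module has a finite free resolution. -/
def AllFFR (R : Type) [CommRing R] : Prop :=
  ∀ (M : Type) [AddCommGroup M] [Module R M], Module.Finite R M → ∃ n, FFR R n M

theorem AllFFR.of_field (k : Type) [Field k] : AllFFR k := by
  intro M _ _ _
  exact ⟨0, FFR.mk_zero (F := Fin 0 → k) (G := M × (Fin 0 → k)) (LinearEquiv.refl k _)⟩

theorem AllFFR.polynomial (A : Type) [CommRing A] [IsNoetherianRing A] (hA : AllFFR A) :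
    AllFFR A[X] := by
  intro M _ _ hM
  obtain ⟨b, f, hf⟩ := Module.Finite.exists_fin' A[X] M
  suffices h : ∃ n, FFR A[X] n (LinearMap.ker f) by
    obtain ⟨n, hn⟩ := h
    exact ⟨n + 1, b, f, hf, hn⟩
  let N : ℕ → Submodule A (LinearMap.ker f) := fun j =>
    { carrier := {v | ∀ i k, j ≤ k → (v.1 i).coeff k = 0}
      zero_mem' := fun i k _ => by simp
      add_mem' := fun {v w} hv hw i k hk => by
        simp [hv i k hk, hw i k hk]
      smul_mem' := fun a v hv i k hk => by
        have : (a • v).1 i = a • (v.1 i) := rfl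
        rw [this, Polynomial.coeff_smul, hv i k hk, smul_zero] }
  have hN : ∀ j v, v ∈ N j ↔ ∀ i k, j ≤ k → (v.1 i).coeff k = 0 := fun j v => Iff.rfl
  have hmono : Monotone N := fun j j' hj v hv i k hk => hv i k (hj.trans hk)
  have hX : ∀ (v : LinearMap.ker f) i, ((X : A[X]) • v).1 i = X * v.1 i := fun v i => rfl
  have hT : ∀ j v, v ∈ N j → (X : A[X]) • v ∈ N (j + 1) := by
    intro j v hv i k hk
    obtain ⟨k, rfl⟩ : ∃ k', k = k' + 1 := ⟨k - 1, by omega⟩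
    rw [hX, coeff_X_mul]
    exact hv i k (by omega)
  have hT' : ∀ j v, (X : A[X]) • v ∈ N (j + 1) → v ∈ N j := by
    intro j v hv i k hk
    have := hv i (k + 1) (by omega)
    rwa [hX, coeff_X_mul] at this
  have hfin : ∀ j, Module.Finite A (N j) := by
    intro j
    let c : N j →ₗ[A] (Fin b → Fin j → A) :=
      { toFun := fun v i k => (v.1.1 i).coeff k
        map_add' := fun v w => by ext; simp
        map_smul' := fun a v => by
          ext i k
          have : (a • v).1.1 i = a • (v.1.1 i) := rfl
          simp only [this, Polynomial.coeff_smul]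
          rfl }
    have hc : Function.Injective c := by
      intro v w hvw
      apply Subtype.ext
      apply Subtype.ext
      ext i k
      by_cases hk : k < j
      · exact congrFun (congrFun hvw i) ⟨k, hk⟩
      · rw [v.2 i k (by omega), w.2 i k (by omega)]
    have := isNoetherian_of_injective c hc
    infer_instance
  obtain ⟨s, hs⟩ := (IsNoetherian.noetherian (⊤ : Submodule A[X] (LinearMap.ker f)))
  let J := s.sup fun v => Finset.univ.sup fun i => (v.1 i).natDegree
  have htop : Submodule.span A[X] (N (J + 1) : Set (LinearMap.ker f)) = ⊤ := by
    rw [eq_top_iff, ← hs]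
    apply Submodule.span_mono
    intro v hv i k hk
    apply Polynomial.coeff_eq_zero_of_natDegree_lt
    have h1 : (v.1 i).natDegree ≤ Finset.univ.sup fun i => (v.1 i).natDegree :=
      Finset.le_sup (f := fun i => (v.1 i).natDegree) (Finset.mem_univ i)
    have h2 : (Finset.univ.sup fun i => (v.1 i).natDegree) ≤ J :=
      Finset.le_sup (f := fun v : LinearMap.ker f => Finset.univ.sup fun i => (v.1 i).natDegree) hv
    omega
  obtain ⟨n1, h1⟩ := hA (N J) (hfin J)
  obtain ⟨n2, h2⟩ := hA (N (J + 1)) (hfin (J + 1))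
  exact ⟨_, swan_ffr N hmono hT hT' J htop (max n1 n2) (h1.mono (le_max_left _ _))
    (h2.mono (le_max_right _ _))⟩

theorem exists_ring (m : ℕ) : ∃ (R : Type) (_ : CommRing R),
    Nonempty (R ≃+* MvPolynomial (Fin m) ℚ) ∧ IsNoetherianRing R ∧ AllFFR R := by
  induction m with
  | zero =>
    exact ⟨ℚ, inferInstance, ⟨(MvPolynomial.isEmptyRingEquiv ℚ (Fin 0)).symm⟩, inferInstance,
      AllFFR.of_field ℚ⟩
  | succ m ih =>
    obtain ⟨R, _, ⟨e⟩, h1, h2⟩ := ih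
    exact ⟨R[X], inferInstance, ⟨(Polynomial.mapEquiv e).trans
      (MvPolynomial.finSuccEquiv ℚ m).symm.toRingEquiv⟩, inferInstance, AllFFR.polynomial R h2⟩

end Swan
end WeylFree


namespace WeylFree
section StablyFreeFree

theorem free_of_prod {R : Type} [CommRing R] (hR : Uni R) {N : Type} [AddCommGroup N] [Module R N]
    {b : ℕ} (e : (N × R) ≃ₗ[R] (Fin b → R)) : Module.Free R N := by
  classical
  let σ : (Fin b → R) →ₗ[R] R := LinearMap.snd R N R ∘ₗ e.symm.toLinearMap
  have hu : ∑ k, σ (Pi.single k 1) * (e (0, 1)) k = 1 := by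
    have h1 : σ (e (0, 1)) = 1 := by simp [σ]
    have h2 := pi_eq_sum_univ' (e (0, 1))
    rw [h2, map_sum] at h1
    conv_rhs => rw [← h1]
    apply Finset.sum_congr rfl
    intro k _
    rw [map_smul, smul_eq_mul, mul_comm]
  obtain ⟨i, r, hr⟩ := hR b (e (0, 1)) _ hu
  let e' := e.trans r
  have he' : e' (0, 1) = Pi.single i 1 := hr
  have he'c : ∀ c : R, e' (0, c) = Pi.single i c := by
    intro c
    have : ((0 : N), c) = c • ((0 : N), (1 : R)) := by simp
    rw [this, map_smul, he']
    ext j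
    simp [Pi.single_apply]
  let p : N →ₗ[R] ({j // j ≠ i} → R) :=
    LinearMap.funLeft R R (fun j : {j // j ≠ i} => j.1) ∘ₗ e'.toLinearMap ∘ₗ LinearMap.inl R N R
  have hp : ∀ n j, p n j = e' (n, 0) j.1 := fun n j => rfl
  have hbij : Function.Bijective p := by
    constructor
    · rw [injective_iff_map_eq_zero]
      intro n hn
      have h1 : e' (n, 0) = e' (0, e' (n, 0) i) := by
        rw [he'c]
        ext j
        by_cases hj : j = i
        · subst hj; simp
        · rw [Pi.single_eq_of_ne hj]
          exact congrFun hn ⟨j, hj⟩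
      exact congrArg Prod.fst (e'.injective h1)
    · intro w
      let x : Fin b → R := fun j => if h : j ≠ i then w ⟨j, h⟩ else 0
      obtain ⟨⟨n, c⟩, hn⟩ := e'.surjective x
      refine ⟨n, ?_⟩
      ext j
      have h1 : ((n, c) : N × R) = (n, 0) + (0, c) := by simp
      rw [h1, map_add, he'c] at hn
      have h2 := congrFun hn j.1
      rw [Pi.add_apply, Pi.single_eq_of_ne j.2, add_zero] at h2
      rw [hp, h2]
      simp [x, j.2]
  exact Module.Free.of_equiv (LinearEquiv.ofBijective p hbij).symm

theorem free_of_prod_pi {R : Type} [CommRing R] (hR : Uni R) (a : ℕ) :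
    ∀ {N : Type} [AddCommGroup N] [Module R N] {b : ℕ}
    (_ : (N × (Fin a → R)) ≃ₗ[R] (Fin b → R)), Module.Free R N := by
  induction a with
  | zero =>
    intro N _ _ b e
    exact Module.Free.of_equiv (e.symm.trans LinearEquiv.prodUnique)
  | succ a ih =>
    intro N _ _ b e
    let c : ((N × (Fin a → R)) × R) ≃ₗ[R] (N × (Fin (a + 1) → R)) :=
      (LinearEquiv.prodAssoc R N (Fin a → R) R).trans
        ((LinearEquiv.refl R N).prodCongr
          ((LinearEquiv.prodComm R (Fin a → R) R).trans (Fin.consLinearEquiv R (fun _ => R))))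
    have hfree := free_of_prod hR (c.trans e)
    have hfin0 : Module.Finite R ((N × (Fin a → R)) × R) := Module.Finite.equiv (c.trans e).symm
    have hfin : Module.Finite R (N × (Fin a → R)) :=
      Module.Finite.of_surjective (LinearMap.fst R (N × (Fin a → R)) R) LinearMap.fst_surjective
    obtain ⟨b', ⟨e''⟩⟩ := finfree_equiv (R := R) (N × (Fin a → R))
    exact ih e''

theorem free_of_projective (m : ℕ) (M : Type) [AddCommGroup M]
    [Module (MvPolynomial (Fin m) ℚ) M] [Module.Finite (MvPolynomial (Fin m) ℚ) M]
    [Module.Projective (MvPolynomial (Fin m) ℚ) M] : Module.Free (MvPolynomial (Fin m) ℚ) M := by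
  obtain ⟨R, _, ⟨e⟩, _, hall⟩ := exists_ring m
  have hR : Uni R := Uni.of_equiv e.symm (uni_mvPolynomial m)
  let _ : Module R M := Module.compHom M (e : R →+* MvPolynomial (Fin m) ℚ)
  have h1 := RingHomInvPair.of_ringEquiv e
  have h2 := h1.symm
  let L : M ≃ₛₗ[(e : R →+* MvPolynomial (Fin m) ℚ)] M :=
    { toFun := id
      invFun := id
      map_add' := fun _ _ => rfl
      map_smul' := fun _ _ => rfl
      left_inv := fun _ => rfl
      right_inv := fun _ => rfl }
  have hfin : Module.Finite R M := Module.Finite.of_surjective L.symm.toLinearMap L.symm.surjective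
  have hproj : Module.Projective R M := Module.Projective.of_equiv L.symm
  obtain ⟨n, hn⟩ := hall M hfin
  obtain ⟨a, b, ⟨k⟩⟩ := hn.stablyFree
  have hfree : Module.Free R M := free_of_prod_pi hR a k
  exact Module.Free.of_equiv L

end StablyFreeFree
end WeylFree

theorem free_of_weyl_action (m : ℕ) (M : Type) [AddCommGroup M]
    [Module ℚ M] [Module (MvPolynomial (Fin m) ℚ) M]
    [IsScalarTower ℚ (MvPolynomial (Fin m) ℚ) M]
    (hfg : Module.Finite (MvPolynomial (Fin m) ℚ) M)
    (D : Fin m → (M →ₗ[ℚ] M))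
    (hcomm : ∀ i j, (D i) ∘ₗ (D j) = (D j) ∘ₗ (D i))
    (hweyl : ∀ (i j : Fin m) (v : M),
      D i ((MvPolynomial.X j : MvPolynomial (Fin m) ℚ) • v) =
        (MvPolynomial.X j : MvPolynomial (Fin m) ℚ) • D i v + (if i = j then v else 0)) :
    Module.Free (MvPolynomial (Fin m) ℚ) M := by
  have hproj := WeylFree.projective_of_weyl m M D hweyl
  exact WeylFree.free_of_projective m M
end
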